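/- Let 0 < α < 1 and 1 < p < ∞. There exists a constant c > 0 such that for every f ∈ Λ_α (Hölder class on the unit circle) and all unitary operators U and V on a separable Hilbert space with U − V ∈ S_p, the operator f(U) − f(V) belongs to S_{p/α} and ‖f(U) − f(V)‖_{S_{p/α}} ≤ c · ‖f‖_{Λ_α} · ‖U − V‖_{S_p}^α. -/

import Mathlib

open scoped BigOperators
noncomputable section

/-- The `j`-th singular value of a bounded operator `T` on a Hilbert space:
`s_j(T) = inf {‖T - R‖ : rank R ≤ j}`. -/
def sVal {H : Type} [NormedAddCommGroup H] [InnerProductSpace ℂ H] [CompleteSpace H]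
    (T : H →L[ℂ] H) (j : ℕ) : ℝ :=
  sInf {c : ℝ | ∃ R : H →L[ℂ] H, LinearMap.rank (R : H →ₗ[ℂ] H) ≤ (j : Cardinal) ∧ c = ‖T - R‖}

/-- Membership in the Schatten–von Neumann class `S_p`. -/
def MemSchatten {H : Type} [NormedAddCommGroup H] [InnerProductSpace ℂ H] [CompleteSpace H]
    (p : ℝ) (T : H →L[ℂ] H) : Prop :=
  Summable fun j : ℕ => sVal T j ^ p

/-- The Schatten–von Neumann norm `‖T‖_{S_p} = (∑_{j ≥ 0} s_j(T)^p)^{1/p}`. -/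
def schNorm {H : Type} [NormedAddCommGroup H] [InnerProductSpace ℂ H] [CompleteSpace H]
    (p : ℝ) (T : H →L[ℂ] H) : ℝ :=
  (∑' j : ℕ, sVal T j ^ p) ^ (1 / p)

/-- `f` satisfies the Hölder condition of order `α` on the unit circle with constant `C`. -/
def HoelderCircleWith (C α : ℝ) (f : ℂ → ℂ) : Prop :=
  ∀ ζ τ : ℂ, ‖ζ‖ = 1 → ‖τ‖ = 1 → ‖f ζ - f τ‖ ≤ C * ‖ζ - τ‖ ^ α

/-- The Hölder norm on the circle, `‖f‖_{Λ_α} = sup_{ζ ≠ τ} |f(ζ) - f(τ)|/|ζ - τ|^α`, realized as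
the least admissible Hölder constant. -/
def hoelderCircleNorm (α : ℝ) (f : ℂ → ℂ) : ℝ :=
  sInf {C : ℝ | 0 ≤ C ∧ HoelderCircleWith C α f}

/-- Membership in the Hölder class `Λ_α` on the unit circle. -/
def MemHoelderCircle (α : ℝ) (f : ℂ → ℂ) : Prop :=
  ∃ C : ℝ, 0 ≤ C ∧ HoelderCircleWith C α f

set_option linter.unusedSectionVars false

section SingularValues

variable {H : Type} [NormedAddCommGroup H] [InnerProductSpace ℂ H] [CompleteSpace H]

open InnerProductSpace

lemma sVal_set_bddBelow (T : H →L[ℂ] H) (j : ℕ) :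
    BddBelow {c : ℝ | ∃ R : H →L[ℂ] H,
      LinearMap.rank (R : H →ₗ[ℂ] H) ≤ (j : Cardinal) ∧ c = ‖T - R‖} := by
  refine ⟨0, ?_⟩
  rintro c ⟨R, -, rfl⟩
  exact norm_nonneg _

lemma sVal_le_norm_sub (T R : H →L[ℂ] H) (j : ℕ)
    (hR : LinearMap.rank (R : H →ₗ[ℂ] H) ≤ (j : Cardinal)) : sVal T j ≤ ‖T - R‖ :=
  csInf_le (sVal_set_bddBelow T j) ⟨R, hR, rfl⟩

lemma sVal_set_nonempty (T : H →L[ℂ] H) (j : ℕ) :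
    {c : ℝ | ∃ R : H →L[ℂ] H,
      LinearMap.rank (R : H →ₗ[ℂ] H) ≤ (j : Cardinal) ∧ c = ‖T - R‖}.Nonempty :=
  ⟨_, 0, by simp, rfl⟩

lemma sVal_nonneg (T : H →L[ℂ] H) (j : ℕ) : 0 ≤ sVal T j := by
  refine le_csInf (sVal_set_nonempty T j) ?_
  rintro c ⟨R, -, rfl⟩
  exact norm_nonneg _

lemma sVal_le_norm (T : H →L[ℂ] H) (j : ℕ) : sVal T j ≤ ‖T‖ := by
  simpa using sVal_le_norm_sub T 0 j (by simp)

lemma sVal_antitone (T : H →L[ℂ] H) : Antitone (sVal T) := by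
  intro i j hij
  refine le_csInf (sVal_set_nonempty T i) ?_
  rintro c ⟨R, hR, rfl⟩
  exact sVal_le_norm_sub T R j (hR.trans (by exact_mod_cast hij))

lemma exists_rank_le_norm_sub_lt (T : H →L[ℂ] H) (j : ℕ) {ε : ℝ} (hε : 0 < ε) :
    ∃ R : H →L[ℂ] H, LinearMap.rank (R : H →ₗ[ℂ] H) ≤ (j : Cardinal) ∧
      ‖T - R‖ < sVal T j + ε := by
  obtain ⟨c, ⟨R, hR, rfl⟩, h⟩ := exists_lt_of_csInf_lt (sVal_set_nonempty T j)
    (show sVal T j < sVal T j + ε by linarith)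
  exact ⟨R, hR, h⟩

lemma sVal_le_add_norm_sub (A B : H →L[ℂ] H) (j : ℕ) : sVal A j ≤ sVal B j + ‖A - B‖ := by
  rw [← sub_le_iff_le_add]
  refine le_csInf (sVal_set_nonempty B j) ?_
  rintro c ⟨R, hR, rfl⟩
  rw [sub_le_iff_le_add]
  refine (sVal_le_norm_sub A R j hR).trans ?_
  calc ‖A - R‖ = ‖(B - R) + (A - B)‖ := by congr 1; abel
    _ ≤ _ := norm_add_le _ _

/-- A variational form of the bound `‖S‖_{S_1} ≤ c`. -/
def TraceNormLe (S : H →L[ℂ] H) (c : ℝ) : Prop :=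
  ∀ (n : ℕ) (e f : Fin n → H), Orthonormal ℂ e → Orthonormal ℂ f →
    ∑ i, ‖inner ℂ (f i) (S (e i))‖ ≤ c

lemma TraceNormLe.add {S S' : H →L[ℂ] H} {c c' : ℝ} (h : TraceNormLe S c)
    (h' : TraceNormLe S' c') : TraceNormLe (S + S') (c + c') := by
  intro n e f he hf
  refine le_trans ?_ (add_le_add (h n e f he hf) (h' n e f he hf))
  rw [← Finset.sum_add_distrib]
  refine Finset.sum_le_sum fun i _ => ?_
  rw [add_apply, inner_add_right]
  exact norm_add_le _ _

lemma TraceNormLe.zero : TraceNormLe (0 : H →L[ℂ] H) 0 := by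
  intro n e f _ _
  simp

lemma TraceNormLe.mono {S : H →L[ℂ] H} {c c' : ℝ} (h : TraceNormLe S c) (hc : c ≤ c') :
    TraceNormLe S c' := fun n e f he hf => (h n e f he hf).trans hc

lemma TraceNormLe.sum {ι : Type*} (s : Finset ι) {S : ι → H →L[ℂ] H} {c : ι → ℝ}
    (h : ∀ i ∈ s, TraceNormLe (S i) (c i)) : TraceNormLe (∑ i ∈ s, S i) (∑ i ∈ s, c i) := by
  classical
  induction s using Finset.induction_on with
  | empty => simpa using TraceNormLe.zero
  | insert a s ha ih =>
    rw [Finset.sum_insert ha, Finset.sum_insert ha]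
    exact (h a (Finset.mem_insert_self _ _)).add
      (ih fun i hi => h i (Finset.mem_insert_of_mem hi))

lemma TraceNormLe.rankOne (x y : H) : TraceNormLe (rankOne ℂ x y) (‖x‖ * ‖y‖) := by
  intro n e f he hf
  have h1 : ∀ i, ‖inner ℂ (f i) (InnerProductSpace.rankOne ℂ x y (e i))‖
      = ‖inner ℂ (e i) y‖ * ‖inner ℂ (f i) x‖ := by
    intro i
    rw [rankOne_apply, inner_smul_right, norm_mul, norm_inner_symm]
  simp_rw [h1]
  have h2 := Finset.sum_mul_sq_le_sq_mul_sq Finset.univ (fun i => ‖inner ℂ (e i) y‖)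
    (fun i => ‖inner ℂ (f i) x‖)
  have h3 := he.sum_inner_products_le y (s := Finset.univ)
  have h4 := hf.sum_inner_products_le x (s := Finset.univ)
  refine abs_le_of_sq_le_sq' ?_ (by positivity) |>.2
  calc _ ≤ _ := h2
    _ ≤ ‖y‖ ^ 2 * ‖x‖ ^ 2 := by gcongr
    _ = _ := by ring

lemma orthonormal_finCons {n : ℕ} {e : Fin n → H} (he : Orthonormal ℂ e) {x : H}
    (hx : ‖x‖ = 1) (hxe : ∀ i, inner ℂ (e i) x = 0) :
    Orthonormal ℂ (Fin.cons x e : Fin (n + 1) → H) := by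
  constructor
  · intro i
    refine Fin.cases ?_ (fun i => ?_) i
    · simpa using hx
    · simpa using he.1 i
  · intro i j
    refine Fin.cases ?_ (fun i => ?_) i <;> refine Fin.cases ?_ (fun j => ?_) j
    · intro h; exact absurd rfl h
    · intro _
      simpa using inner_eq_zero_symm.1 (hxe j)
    · intro _
      simpa using hxe i
    · intro h
      simpa using he.2 (fun h' => h (by rw [h']))

instance hasOrthogonalProjection_span_range {n : ℕ} (e : Fin n → H) :
    (Submodule.span ℂ (Set.range e)).HasOrthogonalProjection :=
  haveI := FiniteDimensional.span_of_finite ℂ (Set.finite_range e)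
  haveI := FiniteDimensional.complete ℂ (Submodule.span ℂ (Set.range e))
  inferInstance

lemma rank_starProjection_span_le {n : ℕ} (e : Fin n → H) :
    LinearMap.rank ((Submodule.span ℂ (Set.range e)).starProjection : H →ₗ[ℂ] H)
      ≤ (n : Cardinal) := by
  rw [LinearMap.rank]
  have : LinearMap.range ((Submodule.span ℂ (Set.range e)).starProjection : H →ₗ[ℂ] H)
      = Submodule.span ℂ (Set.range e) := by simp
  rw [this]
  refine (rank_span_le _).trans ?_
  simpa using Cardinal.mk_range_le (f := e)

/-- Greedy choice of orthonormal systems on which an operator with large singular values is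
large. -/
lemma exists_orthonormal_lt_inner (S : H →L[ℂ] H) {t : ℝ} (ht : 0 ≤ t) (k : ℕ)
    (hk : t < sVal S (2 * k)) (n : ℕ) (hn : n ≤ k + 1) :
    ∃ e f : Fin n → H, Orthonormal ℂ e ∧ Orthonormal ℂ f ∧
      ∀ i, t ≤ ‖inner ℂ (f i) (S (e i))‖ := by
  induction n with
  | zero => exact ⟨Fin.elim0, Fin.elim0, by simp [Orthonormal], by simp [Orthonormal],
      fun i => i.elim0⟩
  | succ n ih =>
    obtain ⟨e, f, he, hf, hef⟩ := ih (by omega)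
    set P := (Submodule.span ℂ (Set.range e)).starProjection with hP
    set Q := (Submodule.span ℂ (Set.range f)).starProjection with hQ
    have hrank : LinearMap.rank ((Q * S + (1 - Q) * S * P : H →L[ℂ] H) : H →ₗ[ℂ] H)
        ≤ ((2 * n : ℕ) : Cardinal) := by
      refine (LinearMap.rank_add_le ((Q * S : H →L[ℂ] H) : H →ₗ[ℂ] H)
        (((1 - Q) * S * P : H →L[ℂ] H) : H →ₗ[ℂ] H)).trans ?_
      have h1 := (LinearMap.rank_comp_le_left (S : H →ₗ[ℂ] H) (Q : H →ₗ[ℂ] H)).trans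
        (rank_starProjection_span_le f)
      have h2 := (LinearMap.rank_comp_le_right (P : H →ₗ[ℂ] H)
        (((1 - Q) * S : H →L[ℂ] H) : H →ₗ[ℂ] H)).trans (rank_starProjection_span_le e)
      refine (add_le_add h1 h2).trans (le_of_eq ?_)
      push_cast; ring
    have hbig : t < ‖(1 - Q) * S * (1 - P)‖ := by
      calc t < sVal S (2 * k) := hk
        _ ≤ sVal S (2 * n) := sVal_antitone S (by omega)
        _ ≤ _ := sVal_le_norm_sub _ _ _ hrank
        _ = _ := by congr 1; noncomm_ring
    obtain ⟨x, hx1, hx⟩ := ContinuousLinearMap.exists_lt_apply_of_lt_opNorm _ hbig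
    set a : H := x - P x with ha
    have hag : ((1 - Q) * S * (1 - P)) x = S a - Q (S a) := by simp [ha]
    rw [hag] at hx
    set g : H := S a - Q (S a) with hg
    have hae : ∀ i, inner ℂ (e i) a = 0 := fun i => inner_eq_zero_symm.1
      (Submodule.starProjection_inner_eq_zero x (e i) (Submodule.subset_span ⟨i, rfl⟩))
    have hgf : ∀ i, inner ℂ (f i) g = 0 := fun i => inner_eq_zero_symm.1
      (Submodule.starProjection_inner_eq_zero (S a) (f i) (Submodule.subset_span ⟨i, rfl⟩))
    have hgQ : inner ℂ g (Q (S a)) = 0 :=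
      Submodule.starProjection_inner_eq_zero (S a) _ (Submodule.starProjection_apply_mem _ _)
    have hgS : inner ℂ g (S a) = (‖g‖ : ℂ) ^ 2 := by
      have : S a = g + Q (S a) := by simp [hg]
      rw [this, inner_add_right, hgQ, add_zero]
      exact inner_self_eq_norm_sq_to_K g
    have hg0 : 0 < ‖g‖ := lt_of_le_of_lt ht hx
    have ha0 : a ≠ 0 := by
      rintro h0
      rw [hg, h0] at hg0
      simp at hg0
    have han : 0 < ‖a‖ := norm_pos_iff.2 ha0
    have hale : ‖a‖ ≤ 1 := by
      have : a = (Submodule.span ℂ (Set.range e))ᗮ.starProjection x := by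
        rw [Submodule.starProjection_orthogonal]; simp [ha, hP]
      rw [this]
      exact (Submodule.norm_starProjection_apply_le _ _).trans hx1.le
    refine ⟨Fin.cons ((‖a‖⁻¹ : ℂ) • a) e, Fin.cons ((‖g‖⁻¹ : ℂ) • g) f,
      orthonormal_finCons he ?_ ?_, orthonormal_finCons hf ?_ ?_, ?_⟩
    · rw [norm_smul]; simp [han.ne']
    · intro i; rw [inner_smul_right, hae, mul_zero]
    · rw [norm_smul]; simp [hg0.ne']
    · intro i; rw [inner_smul_right, hgf, mul_zero]
    · intro i
      refine Fin.cases ?_ (fun i => ?_) i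
      · simp only [Fin.cons_zero, map_smul, inner_smul_left, inner_smul_right, hgS, norm_mul,
          norm_pow]
        simp only [norm_inv, Complex.norm_real, norm_norm, map_inv₀,
          Complex.conj_ofReal]
        rw [show ‖a‖⁻¹ * (‖g‖⁻¹ * ‖g‖ ^ 2) = ‖g‖ / ‖a‖ by field_simp]
        rw [le_div_iff₀ han]
        nlinarith
      · simpa using hef i

lemma sVal_two_mul_le_of_traceNormLe {S : H →L[ℂ] H} {c : ℝ} (h : TraceNormLe S c) (k : ℕ) :
    sVal S (2 * k) ≤ c / (k + 1) := by
  refine le_of_forall_lt fun t ht => ?_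
  rcases lt_or_ge t 0 with h0 | h0
  · have hc : 0 ≤ c := by
      simpa using h 0 Fin.elim0 Fin.elim0 (by simp [Orthonormal]) (by simp [Orthonormal])
    exact h0.trans_le (by positivity)
  obtain ⟨t', ht', ht''⟩ := exists_between ht
  obtain ⟨e, f, he, hf, hef⟩ :=
    exists_orthonormal_lt_inner S (h0.trans ht'.le) k ht'' (k + 1) le_rfl
  have h1 := h (k + 1) e f he hf
  have h2 : ∑ i : Fin (k + 1), t' ≤ ∑ i, ‖inner ℂ (f i) (S (e i))‖ :=
    Finset.sum_le_sum fun i _ => hef i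
  rw [Finset.sum_const, Finset.card_univ, Fintype.card_fin, nsmul_eq_mul] at h2
  refine ht'.trans_le ?_
  rw [le_div_iff₀ (by positivity)]
  push_cast at h2
  linarith

lemma exists_sum_rankOne_of_rank_le (T : H →L[ℂ] H) (r : ℕ)
    (hT : LinearMap.rank (T : H →ₗ[ℂ] H) ≤ (r : Cardinal)) :
    ∃ n ≤ r, ∃ u v : Fin n → H, T = ∑ i, rankOne ℂ (u i) (v i) ∧
      (∀ i, ‖u i‖ ≤ 1) ∧ ∀ i, ‖v i‖ ≤ ‖T‖ := by
  set L := LinearMap.range (T : H →ₗ[ℂ] H) with hL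
  have hfin : FiniteDimensional ℂ L :=
    Module.rank_lt_aleph0_iff.1 (lt_of_le_of_lt hT (Cardinal.natCast_lt_aleph0))
  let b := stdOrthonormalBasis ℂ L
  refine ⟨Module.finrank ℂ L, ?_, fun i => b i, fun i => ContinuousLinearMap.adjoint T (b i),
    ?_, ?_, ?_⟩
  · have h := hT
    rw [LinearMap.rank, ← hL, ← Module.finrank_eq_rank] at h
    exact_mod_cast h
  · ext x
    have h := b.sum_repr' ⟨T x, x, rfl⟩
    have h2 := congrArg Subtype.val h
    simp only [AddSubmonoidClass.coe_finsetSum, Submodule.coe_smul] at h2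
    rw [sum_apply, ← h2]
    refine Finset.sum_congr rfl fun i _ => ?_
    rw [rankOne_apply, ContinuousLinearMap.adjoint_inner_left]
    rfl
  · intro i
    exact (b.norm_eq_one i).le
  · intro i
    refine (ContinuousLinearMap.le_opNorm _ _).trans ?_
    have : ‖((b i : L) : H)‖ = 1 := b.norm_eq_one i
    rw [this, mul_one, LinearIsometryEquiv.norm_map]

/-- A transformer of operators with norm at most `C` both on bounded operators and on the
trace class. -/
structure IsTransformer (Φ : (H →L[ℂ] H) →ₗ[ℂ] (H →L[ℂ] H)) (C : ℝ) : Prop where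
  norm_le : ∀ T, ‖Φ T‖ ≤ C * ‖T‖
  trace_le : ∀ x y, TraceNormLe (Φ (rankOne ℂ x y)) (C * (‖x‖ * ‖y‖))

lemma IsTransformer.add {Φ Ψ : (H →L[ℂ] H) →ₗ[ℂ] (H →L[ℂ] H)} {C D : ℝ}
    (hΦ : IsTransformer Φ C) (hΨ : IsTransformer Ψ D) : IsTransformer (Φ + Ψ) (C + D) where
  norm_le T := by
    rw [LinearMap.add_apply, add_mul]
    exact (norm_add_le _ _).trans (add_le_add (hΦ.norm_le T) (hΨ.norm_le T))
  trace_le x y := by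
    rw [LinearMap.add_apply, add_mul]
    exact (hΦ.trace_le x y).add (hΨ.trace_le x y)

lemma IsTransformer.mono {Φ : (H →L[ℂ] H) →ₗ[ℂ] (H →L[ℂ] H)} {C D : ℝ}
    (hΦ : IsTransformer Φ C) (hCD : C ≤ D) : IsTransformer Φ D where
  norm_le T := (hΦ.norm_le T).trans (by gcongr)
  trace_le x y := (hΦ.trace_le x y).mono (by gcongr)

lemma IsTransformer.traceNormLe_of_rank_le {Φ : (H →L[ℂ] H) →ₗ[ℂ] (H →L[ℂ] H)} {C : ℝ}
    (hC : 0 ≤ C) (hΦ : IsTransformer Φ C) (T : H →L[ℂ] H) (r : ℕ)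
    (hT : LinearMap.rank (T : H →ₗ[ℂ] H) ≤ (r : Cardinal)) :
    TraceNormLe (Φ T) (C * (r * ‖T‖)) := by
  obtain ⟨n, hn, u, v, hTuv, hu, hv⟩ := exists_sum_rankOne_of_rank_le T r hT
  have h1 : TraceNormLe (Φ T) (∑ i : Fin n, C * ‖T‖) := by
    conv => enter [1]; rw [hTuv, map_sum]
    refine TraceNormLe.sum _ fun i _ => (hΦ.trace_le (u i) (v i)).mono ?_
    gcongr
    calc ‖u i‖ * ‖v i‖ ≤ 1 * ‖T‖ := by
          gcongr
          · exact hu i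
          · exact hv i
      _ = ‖T‖ := one_mul _
  refine h1.mono ?_
  rw [Finset.sum_const, Finset.card_univ, Fintype.card_fin, nsmul_eq_mul]
  have : (n : ℝ) ≤ r := by exact_mod_cast hn
  calc (n : ℝ) * (C * ‖T‖) ≤ r * (C * ‖T‖) := by gcongr
    _ = _ := by ring

lemma rank_sub_le_add {A B : H →L[ℂ] H} {m n : ℕ}
    (hA : LinearMap.rank (A : H →ₗ[ℂ] H) ≤ (m : Cardinal))
    (hB : LinearMap.rank (B : H →ₗ[ℂ] H) ≤ (n : Cardinal)) :
    LinearMap.rank ((A - B : H →L[ℂ] H) : H →ₗ[ℂ] H) ≤ ((m + n : ℕ) : Cardinal) := by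
  have h : ((A - B : H →L[ℂ] H) : H →ₗ[ℂ] H)
      = (A : H →ₗ[ℂ] H) + ((-1 : H →ₗ[ℂ] H) ∘ₗ (B : H →ₗ[ℂ] H)) := by
    ext x; simp [sub_eq_add_neg]
  rw [h]
  refine (LinearMap.rank_add_le _ _).trans ?_
  push_cast
  exact add_le_add hA ((LinearMap.rank_comp_le_right _ _).trans hB)

lemma Antitone.two_pow_mul_le_sum_Ico {s : ℕ → ℝ} (hs : Antitone s) (L : ℕ) :
    2 ^ L * s (2 ^ (L + 1) - 1) ≤ ∑ i ∈ Finset.Ico (2 ^ L) (2 ^ (L + 1)), s i := by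
  have h := Finset.card_nsmul_le_sum (Finset.Ico (2 ^ L) (2 ^ (L + 1))) s
    (s (2 ^ (L + 1) - 1)) (fun i hi => hs (by have := Finset.mem_Ico.1 hi; omega))
  rw [Nat.card_Ico, nsmul_eq_mul] at h
  have h2 : 2 ^ (L + 1) - 2 ^ L = 2 ^ L := by rw [pow_succ]; omega
  rw [h2] at h
  push_cast at h
  exact h

/-- The real-interpolation estimate: singular values of a transformed operator are controlled by
the averages of the singular values of the original one. -/
lemma IsTransformer.sVal_two_mul_le {Φ : (H →L[ℂ] H) →ₗ[ℂ] (H →L[ℂ] H)} {C : ℝ}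
    (hC : 0 ≤ C) (hΦ : IsTransformer Φ C) (T : H →L[ℂ] H) (k : ℕ) :
    sVal (Φ T) (2 * k) ≤ 25 * C * ((∑ i ∈ Finset.range (k + 1), sVal T i) / (k + 1)) := by
  set s := sVal T with hs
  have hanti : Antitone s := sVal_antitone T
  have hs0 : ∀ i, 0 ≤ s i := sVal_nonneg T
  suffices hε : ∀ ε > 0, sVal (Φ T) (2 * k) ≤
      25 * C * ((∑ i ∈ Finset.range (k + 1), s i) / (k + 1)) + 25 * C * ε by
    rcases hC.eq_or_lt with h0 | h0
    · have := hε 1 one_pos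
      rw [← h0] at this ⊢
      simpa using this
    · refine le_of_forall_pos_le_add fun δ hδ => ?_
      have := hε (δ / (25 * C)) (by positivity)
      rwa [mul_div_cancel₀ _ (by positivity)] at this
  intro ε hε
  choose R hRr hRn using fun m : ℕ => exists_rank_le_norm_sub_lt T (2 ^ m - 1) hε
  have hstep : ∀ m, TraceNormLe (Φ (R (m + 1) - R m))
      (C * (6 * 2 ^ m * (s (2 ^ m - 1) + ε))) := by
    intro m
    have hr := rank_sub_le_add (hRr (m + 1)) (hRr m)
    refine (hΦ.traceNormLe_of_rank_le hC _ _ hr).mono ?_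
    have h1 : ‖R (m + 1) - R m‖ ≤ 2 * (s (2 ^ m - 1) + ε) := by
      have e1 : R (m + 1) - R m = (T - R m) - (T - R (m + 1)) := by abel
      have e2 : s (2 ^ (m + 1) - 1) ≤ s (2 ^ m - 1) :=
        hanti (Nat.sub_le_sub_right (Nat.pow_le_pow_right (by norm_num) (by omega)) 1)
      have e3 := hRn m
      have e4 := hRn (m + 1)
      calc _ ≤ ‖T - R m‖ + ‖T - R (m + 1)‖ := by rw [e1]; exact norm_sub_le _ _
        _ ≤ _ := by linarith
    have h2 : ((2 ^ (m + 1) - 1 + (2 ^ m - 1) : ℕ) : ℝ) ≤ 3 * 2 ^ m := by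
      have : 2 ^ (m + 1) - 1 + (2 ^ m - 1) ≤ 3 * 2 ^ m := by rw [pow_succ]; omega
      exact_mod_cast this
    calc _ ≤ C * (3 * 2 ^ m * (2 * (s (2 ^ m - 1) + ε))) := by gcongr
      _ = _ := by ring
  have hR0 : R 0 = 0 := by
    have h0 : LinearMap.rank (R 0 : H →ₗ[ℂ] H) ≤ ((0 : ℕ) : Cardinal) := by simpa using hRr 0
    obtain ⟨n, hn, u, v, h, -⟩ := exists_sum_rankOne_of_rank_le (R 0) 0 h0
    obtain rfl : n = 0 := by omega
    simpa using h
  have htr : ∀ L, TraceNormLe (Φ (R (L + 1)))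
      (C * (12 * (s 0 + ∑ i ∈ Finset.range (2 ^ L), s i + 2 ^ L * ε))) := by
    intro L
    induction L with
    | zero =>
      have h := hstep 0
      rw [hR0, sub_zero] at h
      refine h.mono (mul_le_mul_of_nonneg_left ?_ hC)
      simp
      nlinarith [hs0 0]
    | succ L ih =>
      have h := ih.add (hstep (L + 1))
      rw [← map_add, add_sub_cancel] at h
      refine h.mono ?_
      rw [← mul_add]
      gcongr
      have e1 := hanti.two_pow_mul_le_sum_Ico L
      have e2 := Finset.sum_range_add_sum_Ico s (Nat.pow_le_pow_right (n := 2) (by norm_num)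
        (Nat.le_succ L))
      rw [← e2]
      simp only [pow_succ] at e1 ⊢
      nlinarith
  obtain ⟨L, hL1, hL2⟩ : ∃ L, 2 ^ L ≤ k + 1 ∧ k + 1 < 2 ^ (L + 1) :=
    ⟨Nat.log 2 (k + 1), Nat.pow_log_le_self 2 (by omega), Nat.lt_pow_succ_log_self (by norm_num) _⟩
  have h1 := sVal_two_mul_le_of_traceNormLe (htr L) k
  have h2 := sVal_le_add_norm_sub (Φ T) (Φ (R (L + 1))) (2 * k)
  rw [← map_sub] at h2
  have h3 := hΦ.norm_le (T - R (L + 1))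
  have h4 : ‖T - R (L + 1)‖ ≤ s k + ε := by
    refine (hRn (L + 1)).le.trans ?_
    gcongr
    exact hanti (by omega)
  set A := (∑ i ∈ Finset.range (k + 1), s i) / (k + 1) with hA
  have hkpos : (0 : ℝ) < k + 1 := by positivity
  have hS : ∑ i ∈ Finset.range (k + 1), s i = A * (k + 1) := by rw [hA]; field_simp
  have h5 : s k ≤ A := by
    rw [hA, le_div_iff₀ hkpos]
    have h := Finset.card_nsmul_le_sum (Finset.range (k + 1)) s (s k)
      (fun i hi => hanti (by have := Finset.mem_range.1 hi; omega))
    rw [Finset.card_range, nsmul_eq_mul] at h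
    push_cast at h
    linarith
  have h6 : s 0 ≤ A * (k + 1) := by
    rw [← hS]
    exact Finset.single_le_sum (fun i _ => hs0 i) (Finset.mem_range.2 (by omega))
  have h7 : ∑ i ∈ Finset.range (2 ^ L), s i ≤ A * (k + 1) := by
    rw [← hS]
    exact Finset.sum_le_sum_of_subset_of_nonneg (Finset.range_mono hL1) (fun i _ _ => hs0 i)
  have h8 : (2 : ℝ) ^ L ≤ k + 1 := by exact_mod_cast hL1
  have h9 : C * (12 * (s 0 + ∑ i ∈ Finset.range (2 ^ L), s i + 2 ^ L * ε)) / (k + 1)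
      ≤ C * (24 * A + 12 * ε) := by
    rw [div_le_iff₀ hkpos, mul_assoc]
    refine mul_le_mul_of_nonneg_left ?_ hC
    nlinarith
  have h10 : C * ‖T - R (L + 1)‖ ≤ C * (A + ε) := by
    gcongr
    linarith
  nlinarith [mul_nonneg hC hε.le]

end SingularValues

section Hardy

/-- The telescoping step in Hardy's inequality, for consecutive averages `x = A_n`, `y = A_{n-1}`
of a sequence whose `n`-th term is `(n + 1) x - n y`. -/
lemma hardy_step {p q : ℝ} (hpq : p.HolderConjugate q) {x y m : ℝ} (hx : 0 ≤ x) (hy : 0 ≤ y)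
    (hm : 0 ≤ m) :
    x ^ p + (m + 1) * x ^ p / (p - 1) ≤
      q * (x ^ (p - 1) * ((m + 1) * x - m * y)) + m * y ^ p / (p - 1) := by
  have hp1 : 0 < p - 1 := by have := hpq.lt; linarith
  have hp0 : 0 < p := hpq.pos
  have hq : q = p / (p - 1) := hpq.conjugate_eq
  have hyoung := Real.young_inequality_of_nonneg hy (Real.rpow_nonneg hx (p - 1)) hpq
  have e1 : (x ^ (p - 1)) ^ q = x ^ p := by
    rw [← Real.rpow_mul hx, hq]; congr 1; field_simp
  have e2 : x ^ (p - 1) * x = x ^ p := by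
    rcases hx.eq_or_lt with h | h
    · rw [← h, Real.zero_rpow hp0.ne', mul_zero]
    · rw [← Real.rpow_add_one h.ne']; congr 1; ring
  rw [e1] at hyoung
  have key : y * x ^ (p - 1) ≤ y ^ p / p + x ^ p * (p - 1) / p := by
    calc _ ≤ _ := hyoung
      _ = _ := by rw [hq]; field_simp
  have e3 : q * (x ^ (p - 1) * ((m + 1) * x - m * y))
      = q * ((m + 1) * x ^ p - m * (y * x ^ (p - 1))) := by
    rw [← e2]; ring
  rw [e3]
  have hqpos : 0 < q := hpq.symm.pos
  have h4 : q * (m * (y * x ^ (p - 1))) ≤ q * (m * (y ^ p / p + x ^ p * (p - 1) / p)) := by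
    gcongr
  have h5 : q * (m * (y ^ p / p + x ^ p * (p - 1) / p)) = m * y ^ p / (p - 1) + m * x ^ p := by
    rw [hq]; field_simp
  have h6 : q * ((m + 1) * x ^ p) = (m + 1) * x ^ p + (m + 1) * x ^ p / (p - 1) := by
    rw [hq]; field_simp; ring
  rw [mul_sub, h6]
  linarith

/-- Hardy's inequality for finite sums. -/
lemma hardy_sum_le {p : ℝ} (hp : 1 < p) {s : ℕ → ℝ} (hs : ∀ i, 0 ≤ s i) (K : ℕ) :
    ∑ k ∈ Finset.range K, ((∑ i ∈ Finset.range (k + 1), s i) / (k + 1)) ^ p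
      ≤ 2 ^ p / (p - 1) * ∑ k ∈ Finset.range K, s k ^ p := by
  have hpq := Real.HolderConjugate.conjExponent hp
  set q := Real.conjExponent p with hqdef
  have hq : q = p / (p - 1) := hpq.conjugate_eq
  have hp1 : 0 < p - 1 := by linarith
  have hp0 : 0 < p := by linarith
  set A : ℕ → ℝ := fun k => (∑ i ∈ Finset.range (k + 1), s i) / (k + 1) with hA
  have hA0 : ∀ k, 0 ≤ A k := fun k =>
    div_nonneg (Finset.sum_nonneg fun i _ => hs i) (by positivity)
  have hAk : ∀ k, ∑ i ∈ Finset.range (k + 1), s i = (k + 1) * A k := by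
    intro k; simp only [hA]; field_simp
  have hmain : ∀ K : ℕ, ∑ k ∈ Finset.range (K + 1), A k ^ p + (K + 1) * A K ^ p / (p - 1)
      ≤ ∑ k ∈ Finset.range (K + 1), q * (A k ^ (p - 1) * s k) := by
    intro K
    induction K with
    | zero =>
      have h := hardy_step hpq (hA0 0) (hA0 0) le_rfl
      have h0 : A 0 = s 0 := by simp [hA]
      simpa [h0] using h
    | succ K ih =>
      rw [Finset.sum_range_succ, Finset.sum_range_succ _ (K + 1)]
      have h := hardy_step hpq (hA0 (K + 1)) (hA0 K) (m := K + 1) (by positivity)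
      have e : s (K + 1) = (((K : ℝ) + 1) + 1) * A (K + 1) - ((K : ℝ) + 1) * A K := by
        have h1 := hAk (K + 1)
        rw [Finset.sum_range_succ, hAk K] at h1
        push_cast at h1
        linarith
      rw [← e] at h
      push_cast
      linarith
  have hbound : ∑ k ∈ Finset.range K, A k ^ p
      ≤ ∑ k ∈ Finset.range K, q * (A k ^ (p - 1) * s k) := by
    cases K with
    | zero => simp
    | succ K =>
      have h := hmain K
      have : 0 ≤ (K + 1) * A K ^ p / (p - 1) := by have := hA0 K; positivity
      linarith
  have hterm : ∀ k, q * (A k ^ (p - 1) * s k) ≤ A k ^ p / 2 + 2 ^ p / (2 * (p - 1)) * s k ^ p := by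
    intro k
    have hy := Real.young_inequality_of_nonneg (mul_nonneg zero_le_two (hs k))
      (Real.rpow_nonneg (hA0 k) (p - 1)) hpq
    have e1 : (A k ^ (p - 1)) ^ q = A k ^ p := by
      rw [← Real.rpow_mul (hA0 k), hq]; congr 1; field_simp
    rw [e1, Real.mul_rpow zero_le_two (hs k)] at hy
    have hqpos : 0 < q := hpq.symm.pos
    have h2 := mul_le_mul_of_nonneg_left hy (show 0 ≤ q / 2 by positivity)
    calc _ = q / 2 * (2 * s k * A k ^ (p - 1)) := by ring
      _ ≤ _ := h2
      _ = _ := by rw [hq]; field_simp; ring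
  have h3 := hbound.trans (Finset.sum_le_sum fun k _ => hterm k)
  rw [Finset.sum_add_distrib, ← Finset.sum_div, ← Finset.mul_sum] at h3
  have h4 : 2 ^ p / (2 * (p - 1)) * ∑ k ∈ Finset.range K, s k ^ p
      = (2 ^ p / (p - 1) * ∑ k ∈ Finset.range K, s k ^ p) / 2 := by
    field_simp
  rw [h4] at h3
  linarith

end Hardy

section DiscreteFourier

lemma geom_sum_eq_zero_of_pow_eq_one {x : ℂ} {M : ℕ} (hx : x ^ M = 1) (hx1 : x ≠ 1) :
    ∑ r ∈ Finset.range M, x ^ r = 0 := by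
  rw [geom_sum_eq hx1, hx, sub_self, zero_div]

variable {E : Type*} [NormedAddCommGroup E] [InnerProductSpace ℂ E]

/-- Parseval's identity for the vector-valued discrete Fourier transform. -/
lemma sum_norm_sq_dft {M K : ℕ} {η : ℂ} (hη : IsPrimitiveRoot η M) (hM : 0 < M) (hK : K ≤ M)
    (h : ℕ → E) :
    ∑ r ∈ Finset.range M, ‖∑ k ∈ Finset.range K, η ^ (r * k) • h k‖ ^ 2
      = M * ∑ k ∈ Finset.range K, ‖h k‖ ^ 2 := by
  have hη1 : ‖η‖ = 1 := hη.norm'_eq_one hM.ne'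
  have hη0 : η ≠ 0 := by rintro rfl; simp at hη1
  have hconj : (starRingEnd ℂ) η = η⁻¹ := by
    rw [Complex.inv_def, Complex.normSq_eq_norm_sq, hη1]; simp
  have horth : ∀ k ∈ Finset.range K, ∀ l ∈ Finset.range K,
      ∑ r ∈ Finset.range M, (starRingEnd ℂ) (η ^ (r * k)) * η ^ (r * l)
        = if k = l then (M : ℂ) else 0 := by
    intro k hk l hl
    have h1 : ∀ r, (starRingEnd ℂ) (η ^ (r * k)) * η ^ (r * l) = ((η⁻¹) ^ k * η ^ l) ^ r := by
      intro r
      rw [map_pow, hconj, mul_pow, ← pow_mul, ← pow_mul, mul_comm k r, mul_comm l r]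
    simp_rw [h1]
    split_ifs with hkl
    · subst hkl
      have : η⁻¹ ^ k * η ^ k = 1 := by rw [← mul_pow, inv_mul_cancel₀ hη0, one_pow]
      simp only [this, one_pow, Finset.sum_const, Finset.card_range, nsmul_eq_mul, mul_one]
    · apply geom_sum_eq_zero_of_pow_eq_one
      · rw [mul_pow, ← pow_mul, ← pow_mul, mul_comm k, mul_comm l, pow_mul, pow_mul, inv_pow,
          hη.pow_eq_one]
        simp
      · intro h2
        apply hkl
        have h3 : η ^ l = η ^ k := by
          rw [inv_pow] at h2
          field_simp at h2
          exact h2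
        exact hη.pow_inj ((Finset.mem_range.1 hk).trans_le hK)
          ((Finset.mem_range.1 hl).trans_le hK) h3.symm
  have hC : ((∑ r ∈ Finset.range M, ‖∑ k ∈ Finset.range K, η ^ (r * k) • h k‖ ^ 2 : ℝ) : ℂ)
      = ((M * ∑ k ∈ Finset.range K, ‖h k‖ ^ 2 : ℝ) : ℂ) := by
    push_cast
    have h2 : ∀ v : E, ((‖v‖ : ℂ)) ^ 2 = inner ℂ v v := fun v =>
      (inner_self_eq_norm_sq_to_K v).symm
    simp_rw [h2, sum_inner, inner_sum, inner_smul_left, inner_smul_right]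
    rw [Finset.sum_comm, Finset.mul_sum]
    refine Finset.sum_congr rfl fun k hk => ?_
    rw [Finset.sum_comm]
    simp_rw [← mul_assoc, ← Finset.sum_mul]
    rw [Finset.sum_congr rfl fun l hl => by rw [horth k hk l hl]]
    simp only [ite_mul, zero_mul, Finset.sum_ite_eq, hk, if_true]
  exact_mod_cast hC

/-- A finite Toeplitz-type matrix whose entries are discrete Fourier coefficients of a function
bounded by `δ` acts on `ℓ²` with norm at most `δ`. -/
lemma sum_norm_sq_toeplitz_le {M K I : ℕ} {η θ : ℂ} (hη : IsPrimitiveRoot η M)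
    (hθ : IsPrimitiveRoot θ M) (hM : 0 < M) (hK : K ≤ M) (hI : I ≤ M) {γ : ℕ → ℂ} {δ : ℝ}
    (hγ : ∀ r, ‖γ r‖ ≤ δ) (h : ℕ → E) :
    ∑ o ∈ Finset.range I, ‖∑ k ∈ Finset.range K,
        ((M : ℂ)⁻¹ * ∑ r ∈ Finset.range M, γ r * η ^ (r * o) * θ ^ (r * k)) • h k‖ ^ 2
      ≤ δ ^ 2 * ∑ k ∈ Finset.range K, ‖h k‖ ^ 2 := by
  set F : ℕ → E := fun r => (M : ℂ)⁻¹ • γ r • ∑ k ∈ Finset.range K, θ ^ (r * k) • h k with hF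
  have hMpos : (0 : ℝ) < M := by exact_mod_cast hM
  have h1 : ∀ o, ∑ k ∈ Finset.range K,
      ((M : ℂ)⁻¹ * ∑ r ∈ Finset.range M, γ r * η ^ (r * o) * θ ^ (r * k)) • h k
        = ∑ r ∈ Finset.range M, η ^ (o * r) • F r := by
    intro o
    simp_rw [hF, Finset.mul_sum, Finset.sum_smul, Finset.smul_sum]
    rw [Finset.sum_comm]
    refine Finset.sum_congr rfl fun r _ => Finset.sum_congr rfl fun k _ => ?_
    simp only [smul_smul]
    congr 1
    rw [mul_comm o r]
    ring
  simp_rw [h1]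
  calc _ ≤ ∑ o ∈ Finset.range M, ‖∑ r ∈ Finset.range M, η ^ (o * r) • F r‖ ^ 2 :=
        Finset.sum_le_sum_of_subset_of_nonneg (Finset.range_mono hI) fun _ _ _ => by positivity
    _ = M * ∑ r ∈ Finset.range M, ‖F r‖ ^ 2 := sum_norm_sq_dft hη hM le_rfl F
    _ ≤ M * ∑ r ∈ Finset.range M, ((M : ℝ)⁻¹ * δ) ^ 2 *
          ‖∑ k ∈ Finset.range K, θ ^ (r * k) • h k‖ ^ 2 := by
        gcongr with r
        rw [← mul_pow, hF]
        simp only [norm_smul, norm_inv, Complex.norm_natCast]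
        rw [mul_assoc]
        have := hγ r
        gcongr
    _ = _ := by
        rw [← Finset.mul_sum, sum_norm_sq_dft hθ hM hK h]
        field_simp

end DiscreteFourier

section TrigMean

/-- The primitive root of unity generating the interpolation nodes of level `N`. -/
def nodeRoot (N : ℕ) : ℂ := Complex.exp (2 * Real.pi * Complex.I / ((8 * N : ℕ) : ℂ))

lemma nodeRoot_isPrimitiveRoot {N : ℕ} (hN : 0 < N) :
    IsPrimitiveRoot (nodeRoot N) (8 * N) :=
  Complex.isPrimitiveRoot_exp (8 * N) (by omega)

lemma nodeRoot_norm {N : ℕ} (hN : 0 < N) : ‖nodeRoot N‖ = 1 :=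
  (nodeRoot_isPrimitiveRoot hN).norm'_eq_one (by omega)

lemma nodeRoot_ne_zero (N : ℕ) : nodeRoot N ≠ 0 := Complex.exp_ne_zero _

/-- The discrete Fourier coefficient of order `m` with respect to the nodes of level `N`. -/
def nodeCoeff (N : ℕ) (m : ℤ) : (ℂ → ℂ) →ₗ[ℂ] ℂ where
  toFun g := ((8 * N : ℕ) : ℂ)⁻¹ *
    ∑ r ∈ Finset.range (8 * N), g (nodeRoot N ^ r) * (nodeRoot N ^ r) ^ (-m)
  map_add' g h := by simp [add_mul, Finset.sum_add_distrib, mul_add]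
  map_smul' c g := by
    simp only [Pi.smul_apply, smul_eq_mul, RingHom.id_apply, Finset.mul_sum]
    exact Finset.sum_congr rfl fun r _ => by ring

lemma nodeCoeff_apply (N : ℕ) (m : ℤ) (g : ℂ → ℂ) : nodeCoeff N m g = ((8 * N : ℕ) : ℂ)⁻¹ *
    ∑ r ∈ Finset.range (8 * N), g (nodeRoot N ^ r) * (nodeRoot N ^ r) ^ (-m) := rfl

/-- The frequencies occurring in the discrete de la Vallée Poussin mean of level `N`. -/
def meanFreq (N i j k : ℕ) : ℤ := k - (N + j) - i

/-- A smoothed discrete de la Vallée Poussin mean: a trigonometric polynomial of degree at most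
`3 * N` which approximates `g` and reproduces trigonometric polynomials of degree at most `N`. -/
def trigMean (N : ℕ) : (ℂ → ℂ) →ₗ[ℂ] (ℂ → ℂ) where
  toFun g z := ((N : ℂ) ^ 2)⁻¹ * ∑ j ∈ Finset.range N, ∑ i ∈ Finset.range N,
    ∑ k ∈ Finset.range (4 * N), nodeCoeff N (meanFreq N i j k) g * z ^ meanFreq N i j k
  map_add' g h := by
    ext z
    simp only [map_add, add_mul, Finset.sum_add_distrib, mul_add, Pi.add_apply]
  map_smul' c g := by
    ext z
    simp only [map_smul, smul_eq_mul, RingHom.id_apply, Finset.mul_sum, Pi.smul_apply]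
    exact Finset.sum_congr rfl fun _ _ => Finset.sum_congr rfl fun _ _ =>
      Finset.sum_congr rfl fun _ _ => by ring

lemma trigMean_apply (N : ℕ) (g : ℂ → ℂ) (z : ℂ) :
    trigMean N g z = ((N : ℂ) ^ 2)⁻¹ * ∑ j ∈ Finset.range N, ∑ i ∈ Finset.range N,
      ∑ k ∈ Finset.range (4 * N), nodeCoeff N (meanFreq N i j k) g * z ^ meanFreq N i j k := rfl

lemma nodeCoeff_zpow {N : ℕ} (hN : 0 < N) {m n : ℤ} (hmn : |n - m| < 8 * N) :
    nodeCoeff N m (fun z => z ^ n) = if m = n then 1 else 0 := by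
  have hz := nodeRoot_ne_zero N
  have h1 : ∀ r : ℕ, (nodeRoot N ^ r) ^ n * (nodeRoot N ^ r) ^ (-m)
      = (nodeRoot N ^ (n - m)) ^ r := by
    intro r
    rw [← zpow_add₀ (pow_ne_zero r hz), ← zpow_natCast, ← zpow_natCast, ← zpow_mul, ← zpow_mul,
      mul_comm, sub_eq_add_neg]
  rw [nodeCoeff_apply]
  simp_rw [h1]
  split_ifs with h
  · subst h
    have : ((8 * N : ℕ) : ℂ) ≠ 0 := by exact_mod_cast (by omega : 8 * N ≠ 0)
    simp only [sub_self, zpow_zero, one_pow, Finset.sum_const, Finset.card_range, nsmul_eq_mul,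
      mul_one]
    exact inv_mul_cancel₀ this
  · rw [geom_sum_eq_zero_of_pow_eq_one, mul_zero]
    · rw [← zpow_natCast, ← zpow_mul, mul_comm, zpow_mul, zpow_natCast,
        (nodeRoot_isPrimitiveRoot hN).pow_eq_one, one_zpow]
    · intro h2
      rw [(nodeRoot_isPrimitiveRoot hN).zpow_eq_one_iff_dvd] at h2
      have h3 := Int.eq_zero_of_abs_lt_dvd h2 (by push_cast; exact hmn)
      omega

lemma trigMean_zpow {N : ℕ} (hN : 0 < N) {n : ℤ} (hn : |n| ≤ N) (z : ℂ) :
    trigMean N (fun z => z ^ n) z = z ^ n := by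
  rw [abs_le] at hn
  have hsum : ∀ j ∈ Finset.range N, ∀ i ∈ Finset.range N, ∑ k ∈ Finset.range (4 * N),
      nodeCoeff N (meanFreq N i j k) (fun z => z ^ n) * z ^ meanFreq N i j k = z ^ n := by
    intro j hj i hi
    rw [Finset.mem_range] at hi hj
    rw [Finset.sum_eq_single_of_mem (n + (N + j) + i).toNat]
    · have hk : meanFreq N i j (n + (N + j) + i).toNat = n := by
        simp only [meanFreq]; omega
      rw [hk, nodeCoeff_zpow hN (by simp; omega)]
      simp
    · rw [Finset.mem_range]; omega
    · intro k hk hne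
      rw [Finset.mem_range] at hk
      rw [nodeCoeff_zpow hN (by simp only [meanFreq]; rw [abs_lt]; omega), if_neg, zero_mul]
      simp only [meanFreq]; omega
  rw [trigMean_apply, Finset.sum_congr rfl fun j hj => Finset.sum_congr rfl (hsum j hj)]
  have : (N : ℂ) ≠ 0 := by exact_mod_cast hN.ne'
  simp only [Finset.sum_const, Finset.card_range, nsmul_eq_mul]
  field_simp

lemma trigMean_trigMean {N N' : ℕ} (hN' : 0 < N') (h : 3 * N ≤ N') (g : ℂ → ℂ) :
    trigMean N' (trigMean N g) = trigMean N g := by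
  have hrep : trigMean N g = ((N : ℂ) ^ 2)⁻¹ • ∑ j ∈ Finset.range N, ∑ i ∈ Finset.range N,
      ∑ k ∈ Finset.range (4 * N), nodeCoeff N (meanFreq N i j k) g •
        fun z : ℂ => z ^ meanFreq N i j k := by
    ext z
    simp [trigMean_apply]
  rw [hrep]
  simp only [map_smul, map_sum]
  congr 1
  refine Finset.sum_congr rfl fun j hj => Finset.sum_congr rfl fun i hi =>
    Finset.sum_congr rfl fun k hk => ?_
  congr 1
  rw [Finset.mem_range] at hi hj hk
  ext z
  refine trigMean_zpow hN' ?_ z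
  simp only [meanFreq]
  rw [abs_le]
  omega

lemma trigMean_const {N : ℕ} (hN : 0 < N) (c z : ℂ) : trigMean N (fun _ => c) z = c := by
  have h : (fun _ : ℂ => c) = c • fun z : ℂ => z ^ (0 : ℤ) := by ext; simp
  rw [h, map_smul, Pi.smul_apply, trigMean_zpow hN (by simp)]
  simp

/-- The kernel of the mean `trigMean`. -/
lemma trigMean_eq_sum_kernel {N : ℕ} (g : ℂ → ℂ) {z : ℂ} (hz : z ≠ 0) :
    trigMean N g z = ∑ r ∈ Finset.range (8 * N), g (nodeRoot N ^ r) *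
      ((((8 * N : ℕ) : ℂ) * (N : ℂ) ^ 2)⁻¹ * ((z / nodeRoot N ^ r) ^ (-(N : ℤ)) *
        (∑ k ∈ Finset.range (4 * N), (z / nodeRoot N ^ r) ^ k) *
        (∑ i ∈ Finset.range N, ((z / nodeRoot N ^ r)⁻¹) ^ i) ^ 2)) := by
  have hexp : ∀ y : ℂ, y ≠ 0 → y ^ (-(N : ℤ)) * (∑ k ∈ Finset.range (4 * N), y ^ k) *
      (∑ i ∈ Finset.range N, (y⁻¹) ^ i) ^ 2 = ∑ j ∈ Finset.range N, ∑ i ∈ Finset.range N,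
        ∑ k ∈ Finset.range (4 * N), y ^ meanFreq N i j k := by
    intro y hy
    rw [sq, Finset.sum_mul_sum, Finset.mul_sum]
    refine Finset.sum_congr rfl fun j _ => ?_
    rw [Finset.mul_sum]
    refine Finset.sum_congr rfl fun i _ => ?_
    rw [Finset.mul_sum, Finset.sum_mul]
    refine Finset.sum_congr rfl fun k _ => ?_
    rw [← zpow_natCast, ← zpow_natCast, ← zpow_natCast, inv_zpow', inv_zpow', ← zpow_add₀ hy,
      ← zpow_add₀ hy, ← zpow_add₀ hy]
    congr 1
    simp only [meanFreq]; ring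
  have h1 : ∀ r, z / nodeRoot N ^ r ≠ 0 := fun r =>
    div_ne_zero hz (pow_ne_zero r (nodeRoot_ne_zero N))
  simp_rw [hexp _ (h1 _), trigMean_apply, nodeCoeff_apply, Finset.mul_sum, Finset.sum_mul]
  symm
  rw [Finset.sum_comm]
  refine Finset.sum_congr rfl fun j _ => ?_
  rw [Finset.sum_comm]
  refine Finset.sum_congr rfl fun i _ => ?_
  rw [Finset.sum_comm]
  refine Finset.sum_congr rfl fun k _ => ?_
  rw [Finset.mul_sum]
  refine Finset.sum_congr rfl fun r _ => ?_
  rw [div_eq_mul_inv z, mul_zpow, inv_zpow', mul_inv]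
  ring

lemma rpow_le_scaled {t α : ℝ} (ht : 0 ≤ t) (hα0 : 0 < α) (hα1 : α < 1) {n : ℝ} (hn : 0 < n) :
    t ^ α ≤ n ^ (-α) * (1 + n * t) := by
  have h1 : (n * t) ^ α ≤ 1 + n * t := by
    rcases le_total (n * t) 1 with h | h
    · have := Real.rpow_le_one (by positivity) h hα0.le
      nlinarith [mul_nonneg hn.le ht]
    · have := Real.rpow_le_rpow_of_exponent_le h hα1.le
      rw [Real.rpow_one] at this
      linarith
  calc t ^ α = n ^ (-α) * (n * t) ^ α := by
        rw [Real.mul_rpow hn.le ht, ← mul_assoc, ← Real.rpow_add hn]; simp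
    _ ≤ _ := by gcongr

/-- Direct approximation theorem for Hölder functions on the circle. -/
lemma norm_sub_trigMean_le {N : ℕ} (hN : 0 < N) {C α : ℝ} (hC : 0 ≤ C) (hα0 : 0 < α)
    (hα1 : α < 1) {f : ℂ → ℂ} (hf : HoelderCircleWith C α f) {z : ℂ} (hz : ‖z‖ = 1) :
    ‖f z - trigMean N f z‖ ≤ 4 * C * (N : ℝ) ^ (-α) := by
  have hz0 : z ≠ 0 := by rintro rfl; simp at hz
  have hNpos : (0 : ℝ) < N := by exact_mod_cast hN
  set w : ℕ → ℂ := fun r => nodeRoot N ^ r with hw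
  have hwn : ∀ r, ‖w r‖ = 1 := fun r => by simp [hw, nodeRoot_norm hN]
  have hw0 : ∀ r, w r ≠ 0 := fun r => pow_ne_zero r (nodeRoot_ne_zero N)
  set a : ℕ → ℂ := fun r => ∑ k ∈ Finset.range (4 * N), (z / w r) ^ k with ha
  set b : ℕ → ℂ := fun r => ∑ i ∈ Finset.range N, ((z / w r)⁻¹) ^ i with hb
  set K : ℕ → ℂ := fun r => (((8 * N : ℕ) : ℂ) * (N : ℂ) ^ 2)⁻¹ *
    ((z / w r) ^ (-(N : ℤ)) * a r * b r ^ 2) with hK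
  have hy : ∀ r, ‖z / w r‖ = 1 := fun r => by rw [norm_div, hz, hwn, div_one]
  have hKn : ∀ r, ‖K r‖ = (8 * N * (N : ℝ) ^ 2)⁻¹ * (‖a r‖ * ‖b r‖ ^ 2) := by
    intro r
    simp only [hK, norm_mul, norm_inv, norm_pow, norm_zpow, hy r, one_zpow, one_mul,
      Complex.norm_natCast]
    push_cast
    rfl
  have hbN : ∀ r, ‖b r‖ ≤ N := by
    intro r
    refine (norm_sum_le _ _).trans ?_
    simp [hz, hwn]
  have haN : ∀ r, ‖z - w r‖ * ‖a r‖ ≤ 2 := by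
    intro r
    have h1 : ‖z - w r‖ = ‖z / w r - 1‖ := by
      rw [div_sub_one (hw0 r), norm_div, hwn, div_one]
    rw [h1, ← norm_mul, mul_comm, ha]
    simp only
    rw [geom_sum_mul]
    refine (norm_sub_le _ _).trans ?_
    rw [norm_pow, hy]
    norm_num
  have hprim := nodeRoot_isPrimitiveRoot hN
  have hasum : ∑ r ∈ Finset.range (8 * N), ‖a r‖ ^ 2 = 8 * N * (4 * N) := by
    have h := sum_norm_sq_dft hprim.inv (by omega) (show 4 * N ≤ 8 * N by omega)
      (fun k => z ^ k)
    have h2 : ∀ r, ∑ k ∈ Finset.range (4 * N), (nodeRoot N)⁻¹ ^ (r * k) • z ^ k = a r := by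
      intro r
      refine Finset.sum_congr rfl fun k _ => ?_
      rw [smul_eq_mul, div_pow, pow_mul, inv_pow, inv_pow, div_eq_mul_inv, mul_comm]
    simp_rw [h2] at h
    rw [h]
    simp [norm_pow, hz]
  have hbsum : ∑ r ∈ Finset.range (8 * N), ‖b r‖ ^ 2 = 8 * N * N := by
    have h := sum_norm_sq_dft hprim (by omega) (show N ≤ 8 * N by omega)
      (fun k => (z⁻¹) ^ k)
    have h2 : ∀ r, ∑ k ∈ Finset.range N, nodeRoot N ^ (r * k) • (z⁻¹) ^ k = b r := by
      intro r
      refine Finset.sum_congr rfl fun k _ => ?_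
      rw [smul_eq_mul, inv_div, div_pow, pow_mul, inv_pow, div_eq_mul_inv]
    simp_rw [h2] at h
    rw [h]
    simp [norm_pow, hz]
  have hK1 : ∑ r ∈ Finset.range (8 * N), ‖K r‖ ≤ 2 := by
    have h1 : ∀ r, ‖K r‖ ≤ (8 * N * (N : ℝ) ^ 2)⁻¹ * (N * (‖a r‖ ^ 2 / 4 + ‖b r‖ ^ 2)) := by
      intro r
      rw [hKn]
      refine mul_le_mul_of_nonneg_left ?_ (by positivity)
      have h2 : ‖a r‖ * ‖b r‖ ≤ ‖a r‖ ^ 2 / 4 + ‖b r‖ ^ 2 := by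
        nlinarith [sq_nonneg (‖a r‖ / 2 - ‖b r‖)]
      calc ‖a r‖ * ‖b r‖ ^ 2 = ‖b r‖ * (‖a r‖ * ‖b r‖) := by ring
        _ ≤ _ := mul_le_mul (hbN r) h2 (by positivity) hNpos.le
    refine (Finset.sum_le_sum fun r _ => h1 r).trans (le_of_eq ?_)
    rw [← Finset.mul_sum, ← Finset.mul_sum, Finset.sum_add_distrib, ← Finset.sum_div, hasum, hbsum]
    field_simp
    ring
  have hK2 : ∑ r ∈ Finset.range (8 * N), ‖z - w r‖ * ‖K r‖ ≤ 2 / N := by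
    have h1 : ∀ r, ‖z - w r‖ * ‖K r‖ ≤ (8 * N * (N : ℝ) ^ 2)⁻¹ * (2 * ‖b r‖ ^ 2) := by
      intro r
      rw [hKn]
      calc _ = (8 * N * (N : ℝ) ^ 2)⁻¹ * ((‖z - w r‖ * ‖a r‖) * ‖b r‖ ^ 2) := by ring
        _ ≤ _ := by gcongr; exact haN r
    refine (Finset.sum_le_sum fun r _ => h1 r).trans (le_of_eq ?_)
    rw [← Finset.mul_sum, ← Finset.mul_sum, hbsum]
    field_simp
  have hone : ∑ r ∈ Finset.range (8 * N), K r = 1 := by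
    have h := trigMean_eq_sum_kernel (N := N) (fun _ => 1) hz0
    rw [trigMean_const hN] at h
    simp only [one_mul] at h
    exact h.symm
  have hdiff : f z - trigMean N f z = ∑ r ∈ Finset.range (8 * N), (f z - f (w r)) * K r := by
    rw [trigMean_eq_sum_kernel f hz0]
    simp_rw [sub_mul]
    rw [Finset.sum_sub_distrib, ← Finset.mul_sum, hone, mul_one]
  rw [hdiff]
  refine (norm_sum_le _ _).trans ?_
  calc ∑ r ∈ Finset.range (8 * N), ‖(f z - f (w r)) * K r‖
      ≤ ∑ r ∈ Finset.range (8 * N),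
          C * (N : ℝ) ^ (-α) * (‖K r‖ + N * (‖z - w r‖ * ‖K r‖)) := by
        refine Finset.sum_le_sum fun r _ => ?_
        rw [norm_mul]
        calc ‖f z - f (w r)‖ * ‖K r‖ ≤ (C * ((N : ℝ) ^ (-α) * (1 + N * ‖z - w r‖))) * ‖K r‖ := by
              gcongr
              refine (hf z (w r) hz (hwn r)).trans ?_
              gcongr
              exact rpow_le_scaled (norm_nonneg _) hα0 hα1 hNpos
          _ = _ := by ring
    _ = C * (N : ℝ) ^ (-α) * (∑ r ∈ Finset.range (8 * N), ‖K r‖ +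
          N * ∑ r ∈ Finset.range (8 * N), ‖z - w r‖ * ‖K r‖) := by
        rw [← Finset.mul_sum, Finset.sum_add_distrib, ← Finset.mul_sum]
    _ ≤ C * (N : ℝ) ^ (-α) * (2 + N * (2 / N)) := by gcongr
    _ = _ := by field_simp; ring

end TrigMean

section Bernstein

variable {H : Type} [NormedAddCommGroup H] [InnerProductSpace ℂ H] [CompleteSpace H]

open InnerProductSpace ContinuousLinearMap

lemma IsTransformer.zero : IsTransformer (0 : (H →L[ℂ] H) →ₗ[ℂ] (H →L[ℂ] H)) 0 where
  norm_le T := by simp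
  trace_le x y := by simpa using TraceNormLe.zero

lemma IsTransformer.sum {ι : Type*} (s : Finset ι) {Φ : ι → (H →L[ℂ] H) →ₗ[ℂ] (H →L[ℂ] H)}
    {C : ι → ℝ} (h : ∀ i ∈ s, IsTransformer (Φ i) (C i)) :
    IsTransformer (∑ i ∈ s, Φ i) (∑ i ∈ s, C i) := by
  classical
  induction s using Finset.induction_on with
  | empty => simpa using IsTransformer.zero
  | insert a s ha ih =>
    rw [Finset.sum_insert ha, Finset.sum_insert ha]
    exact (h a (Finset.mem_insert_self _ _)).add
      (ih fun i hi => h i (Finset.mem_insert_of_mem hi))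

lemma IsTransformer.smul {Φ : (H →L[ℂ] H) →ₗ[ℂ] (H →L[ℂ] H)} {C : ℝ}
    (hΦ : IsTransformer Φ C) (c : ℂ) : IsTransformer (c • Φ) (‖c‖ * C) where
  norm_le T := by
    rw [LinearMap.smul_apply, norm_smul, mul_assoc]
    gcongr
    exact hΦ.norm_le T
  trace_le x y n e f he hf := by
    simp only [LinearMap.smul_apply, smul_apply, inner_smul_right, norm_mul]
    rw [← Finset.mul_sum, mul_assoc]
    gcongr
    exact hΦ.trace_le x y n e f he hf

lemma isTransformer_sum_mulLeftRight {ι : Type*} (s : Finset ι) (X Y : ι → H →L[ℂ] H) {C : ℝ}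
    (h1 : ∀ x y, ∑ i ∈ s, ‖X i x‖ * ‖adjoint (Y i) y‖ ≤ C * (‖x‖ * ‖y‖))
    (h2 : ∀ x y, ∑ i ∈ s, ‖adjoint (X i) x‖ * ‖Y i y‖ ≤ C * (‖x‖ * ‖y‖)) (hC : 0 ≤ C) :
    IsTransformer (∑ i ∈ s, LinearMap.mulLeftRight ℂ (X i, Y i)) C where
  norm_le T := by
    refine opNorm_le_bound _ (by positivity) fun h => ?_
    set v := (∑ i ∈ s, LinearMap.mulLeftRight ℂ (X i, Y i)) T h with hv
    have hv' : v = ∑ i ∈ s, X i (T (Y i h)) := by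
      simp [hv, LinearMap.sum_apply, sum_apply]
    rcases eq_or_ne v 0 with h0 | h0
    · rw [h0, norm_zero]; positivity
    have hpos : 0 < ‖v‖ := norm_pos_iff.2 h0
    have h3 : ‖v‖ * ‖v‖ ≤ ‖T‖ * (C * (‖v‖ * ‖h‖)) := by
      calc ‖v‖ * ‖v‖ = ‖inner ℂ v v‖ := by
            rw [inner_self_eq_norm_sq_to_K]; simp [sq]
        _ = ‖∑ i ∈ s, inner ℂ (adjoint (X i) v) (T (Y i h))‖ := by
            congr 1
            rw [show inner ℂ v v = inner ℂ v (∑ i ∈ s, X i (T (Y i h))) from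
              congrArg (inner ℂ v) hv', inner_sum]
            exact Finset.sum_congr rfl fun i _ => (adjoint_inner_left _ _ _).symm
        _ ≤ ∑ i ∈ s, ‖T‖ * (‖adjoint (X i) v‖ * ‖Y i h‖) := by
            refine norm_sum_le_of_le _ fun i _ => (norm_inner_le_norm _ _).trans ?_
            calc _ ≤ ‖adjoint (X i) v‖ * (‖T‖ * ‖Y i h‖) := by gcongr; exact le_opNorm _ _
              _ = _ := by ring
        _ ≤ _ := by rw [← Finset.mul_sum]; gcongr; exact h2 v h
    refine le_of_mul_le_mul_right ?_ hpos
    linarith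
  trace_le x y := by
    have h3 : (∑ i ∈ s, LinearMap.mulLeftRight ℂ (X i, Y i)) (rankOne ℂ x y)
        = ∑ i ∈ s, rankOne ℂ (X i x) (adjoint (Y i) y) := by
      rw [LinearMap.sum_apply]
      refine Finset.sum_congr rfl fun i _ => ?_
      ext z
      simp [adjoint_inner_left]
    rw [h3]
    exact (TraceNormLe.sum s fun i _ => TraceNormLe.rankOne _ _).mono (h1 x y)

lemma norm_unitary_apply (U : unitary (H →L[ℂ] H)) (x : H) : ‖(U : H →L[ℂ] H) x‖ = ‖x‖ :=
  norm_map_of_mem_unitary U.2 x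

lemma norm_adjoint_unitary_apply (U : unitary (H →L[ℂ] H)) (x : H) :
    ‖adjoint (U : H →L[ℂ] H) x‖ = ‖x‖ :=
  norm_unitary_apply (star U) x

/-- Differences of integer powers of unitary operators factor through the difference of the
operators. -/
lemma unitary_zpow_sub_zpow (U V : unitary (H →L[ℂ] H)) (k : ℤ) :
    ∃ (ε : ℂ) (l m : ℕ → ℤ), ‖ε‖ = 1 ∧ ((U ^ k : unitary (H →L[ℂ] H)) : H →L[ℂ] H)
      - ((V ^ k : unitary (H →L[ℂ] H)) : H →L[ℂ] H)
        = ε • ∑ i ∈ Finset.range k.natAbs, ((U ^ l i : unitary (H →L[ℂ] H)) : H →L[ℂ] H) *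
          ((U : H →L[ℂ] H) - V) * ((V ^ m i : unitary (H →L[ℂ] H)) : H →L[ℂ] H) := by
  have hnat : ∀ n : ℕ, ((U ^ n : unitary (H →L[ℂ] H)) : H →L[ℂ] H)
      - ((V ^ n : unitary (H →L[ℂ] H)) : H →L[ℂ] H) = ∑ i ∈ Finset.range n,
        ((U ^ (i : ℤ) : unitary (H →L[ℂ] H)) : H →L[ℂ] H) *
          ((U : H →L[ℂ] H) - V) * ((V ^ ((n : ℤ) - 1 - i) : unitary (H →L[ℂ] H)) : H →L[ℂ] H) := by
    intro n
    have hterm : ∀ i ∈ Finset.range n, ((U ^ (i : ℤ) : unitary (H →L[ℂ] H)) : H →L[ℂ] H) *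
          ((U : H →L[ℂ] H) - V) * ((V ^ ((n : ℤ) - 1 - i) : unitary (H →L[ℂ] H)) : H →L[ℂ] H)
        = ((U ^ ((i + 1 : ℕ) : ℤ) * V ^ ((n : ℤ) - (i + 1 : ℕ)) : unitary (H →L[ℂ] H)) :
            H →L[ℂ] H) - ((U ^ (i : ℤ) * V ^ ((n : ℤ) - i) : unitary (H →L[ℂ] H)) : H →L[ℂ] H) := by
      intro i _
      have e1 : U ^ ((i + 1 : ℕ) : ℤ) = U ^ (i : ℤ) * U := by
        push_cast; rw [zpow_add_one]
      have e2 : V ^ ((n : ℤ) - i) = V * V ^ ((n : ℤ) - 1 - i) := by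
        rw [← zpow_one_add]; congr 1; ring
      have e3 : V ^ ((n : ℤ) - (i + 1 : ℕ)) = V ^ ((n : ℤ) - 1 - i) := by
        congr 1; push_cast; ring
      rw [e1, e2, e3]
      push_cast
      noncomm_ring
    rw [Finset.sum_congr rfl hterm, Finset.sum_range_sub (fun i : ℕ =>
      ((U ^ (i : ℤ) * V ^ ((n : ℤ) - i) : unitary (H →L[ℂ] H)) : H →L[ℂ] H))]
    simp
  rcases Int.natAbs_eq k with hk | hk
  · refine ⟨1, fun i => i, fun i => (k.natAbs : ℤ) - 1 - i, by simp, ?_⟩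
    rw [one_smul, ← hnat, ← zpow_natCast, ← zpow_natCast, ← hk]
  · refine ⟨-1, fun i => (i : ℤ) - k.natAbs, fun i => -1 - i, by simp, ?_⟩
    have hU : ∀ i : ℕ, U ^ ((i : ℤ) - k.natAbs) = U ^ k * U ^ (i : ℤ) := by
      intro i
      rw [← zpow_add]; congr 1; omega
    have hV : ∀ i : ℕ, V ^ (-1 - (i : ℤ)) = V ^ ((k.natAbs : ℤ) - 1 - i) * V ^ k := by
      intro i
      rw [← zpow_add]; congr 1; omega
    have hpowU : ((U ^ k : unitary (H →L[ℂ] H)) : H →L[ℂ] H) *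
        ((U ^ k.natAbs : unitary (H →L[ℂ] H)) : H →L[ℂ] H) = 1 := by
      refine congrArg Subtype.val (show U ^ k * U ^ k.natAbs = 1 from ?_)
      rw [← zpow_natCast, ← zpow_add, show k + (k.natAbs : ℤ) = 0 by omega, zpow_zero]
    have hpowV : ((V ^ k.natAbs : unitary (H →L[ℂ] H)) : H →L[ℂ] H) *
        ((V ^ k : unitary (H →L[ℂ] H)) : H →L[ℂ] H) = 1 := by
      refine congrArg Subtype.val (show V ^ k.natAbs * V ^ k = 1 from ?_)
      rw [← zpow_natCast, ← zpow_add, show (k.natAbs : ℤ) + k = 0 by omega, zpow_zero]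
    have hsum : ∑ i ∈ Finset.range k.natAbs,
        ((U ^ ((i : ℤ) - k.natAbs) : unitary (H →L[ℂ] H)) : H →L[ℂ] H) *
          ((U : H →L[ℂ] H) - V) * ((V ^ (-1 - (i : ℤ)) : unitary (H →L[ℂ] H)) : H →L[ℂ] H)
        = ((U ^ k : unitary (H →L[ℂ] H)) : H →L[ℂ] H) *
          (((U ^ k.natAbs : unitary (H →L[ℂ] H)) : H →L[ℂ] H)
            - ((V ^ k.natAbs : unitary (H →L[ℂ] H)) : H →L[ℂ] H)) *
          ((V ^ k : unitary (H →L[ℂ] H)) : H →L[ℂ] H) := by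
      rw [hnat, Finset.mul_sum, Finset.sum_mul]
      refine Finset.sum_congr rfl fun i _ => ?_
      rw [hU, hV]
      simp only [Submonoid.coe_mul, mul_assoc]
    rw [hsum, mul_sub, sub_mul, hpowU, mul_assoc _ _ ((V ^ k : unitary (H →L[ℂ] H)) : H →L[ℂ] H),
      hpowV, one_mul, mul_one, neg_smul, one_smul, neg_sub]

lemma clm_mul_apply (A B : H →L[ℂ] H) (x : H) : (A * B) x = A (B x) := rfl

lemma exists_transformer_sum_zpow (U V : unitary (H →L[ℂ] H)) (n : ℕ) (κ : ℕ → ℤ) (D : ℕ)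
    (hκ : ∀ k < n, (κ k).natAbs ≤ D) (Z W : ℕ → H →L[ℂ] H) {A : ℝ} (hA : 0 ≤ A)
    (hZ : ∀ k x, ‖adjoint (Z k) x‖ = ‖Z k x‖) (hW : ∀ k x, ‖adjoint (W k) x‖ = ‖W k x‖)
    (hZU : ∀ k (l : ℤ), Commute (Z k) ((U ^ l : unitary (H →L[ℂ] H)) : H →L[ℂ] H))
    (hWV : ∀ k (l : ℤ), Commute (W k) ((V ^ l : unitary (H →L[ℂ] H)) : H →L[ℂ] H))
    (hZW : ∀ x y, ∑ k ∈ Finset.range n, ‖Z k x‖ * ‖W k y‖ ≤ A * (‖x‖ * ‖y‖)) :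
    ∃ Φ : (H →L[ℂ] H) →ₗ[ℂ] (H →L[ℂ] H), IsTransformer Φ (D * A) ∧
      Φ (U - V) = ∑ k ∈ Finset.range n, Z k * (((U ^ κ k : unitary (H →L[ℂ] H)) : H →L[ℂ] H)
        - ((V ^ κ k : unitary (H →L[ℂ] H)) : H →L[ℂ] H)) * W k := by
  choose ε l m hε heq using fun k => unitary_zpow_sub_zpow U V (κ k)
  let s : Finset (Σ _ : ℕ, ℕ) := (Finset.range n).sigma fun k => Finset.range (κ k).natAbs
  let X : (Σ _ : ℕ, ℕ) → H →L[ℂ] H := fun q =>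
    ε q.1 • (Z q.1 * ((U ^ l q.1 q.2 : unitary (H →L[ℂ] H)) : H →L[ℂ] H))
  let Y : (Σ _ : ℕ, ℕ) → H →L[ℂ] H := fun q =>
    ((V ^ m q.1 q.2 : unitary (H →L[ℂ] H)) : H →L[ℂ] H) * W q.1
  have hX1 : ∀ q x, ‖X q x‖ = ‖Z q.1 x‖ := by
    intro q x
    simp only [X]
    rw [(hZU q.1 _).eq, smul_apply, norm_smul, hε, one_mul, clm_mul_apply, norm_unitary_apply]
  have hX2 : ∀ q x, ‖adjoint (X q) x‖ = ‖Z q.1 x‖ := by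
    intro q x
    simp only [X]
    rw [← star_eq_adjoint, star_smul, star_mul, smul_apply, norm_smul, norm_star, hε, one_mul,
      clm_mul_apply, star_eq_adjoint, star_eq_adjoint, norm_adjoint_unitary_apply, hZ]
  have hY1 : ∀ q x, ‖Y q x‖ = ‖W q.1 x‖ := by
    intro q x
    simp only [Y]
    rw [clm_mul_apply, norm_unitary_apply]
  have hY2 : ∀ q x, ‖adjoint (Y q) x‖ = ‖W q.1 x‖ := by
    intro q x
    simp only [Y]
    rw [← (hWV q.1 _).eq, ← star_eq_adjoint, star_mul, clm_mul_apply, star_eq_adjoint,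
      star_eq_adjoint, norm_adjoint_unitary_apply, hW]
  have hbound : ∀ x y, ∑ q ∈ s, ‖Z q.1 x‖ * ‖W q.1 y‖ ≤ D * A * (‖x‖ * ‖y‖) := by
    intro x y
    rw [Finset.sum_sigma]
    simp only [Finset.sum_const, Finset.card_range, nsmul_eq_mul]
    calc _ ≤ ∑ k ∈ Finset.range n, (D : ℝ) * (‖Z k x‖ * ‖W k y‖) := by
          gcongr with k hk
          exact_mod_cast hκ k (Finset.mem_range.1 hk)
      _ ≤ D * (A * (‖x‖ * ‖y‖)) := by rw [← Finset.mul_sum]; gcongr; exact hZW x y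
      _ = _ := by ring
  refine ⟨_, isTransformer_sum_mulLeftRight s X Y (C := D * A) (fun x y => ?_) (fun x y => ?_)
    (by positivity), ?_⟩
  · simp_rw [hX1, hY2]; exact hbound x y
  · simp_rw [hX2, hY1]; exact hbound x y
  · rw [LinearMap.sum_apply, Finset.sum_sigma]
    refine Finset.sum_congr rfl fun k _ => ?_
    rw [heq k]
    simp only [LinearMap.mulLeftRight_apply, X, Y, smul_mul_assoc, mul_smul_comm, Finset.smul_sum,
      Finset.mul_sum, Finset.sum_mul, mul_assoc]

lemma commute_sum_smul_zpow (U : unitary (H →L[ℂ] H)) (n : ℕ) (c : ℕ → ℂ) (μ : ℕ → ℤ) (l : ℤ) :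
    Commute (∑ i ∈ Finset.range n, c i • ((U ^ μ i : unitary (H →L[ℂ] H)) : H →L[ℂ] H))
      ((U ^ l : unitary (H →L[ℂ] H)) : H →L[ℂ] H) := by
  refine Commute.sum_left _ _ _ fun i _ => Commute.smul_left ?_ _
  have h := (Commute.refl U).zpow_zpow (μ i) l
  exact congrArg Subtype.val h.eq

lemma norm_adjoint_sum_smul_zpow (U : unitary (H →L[ℂ] H)) (n : ℕ) (c : ℕ → ℂ) (μ : ℕ → ℤ)
    (x : H) :
    ‖adjoint (∑ i ∈ Finset.range n, c i • ((U ^ μ i : unitary (H →L[ℂ] H)) : H →L[ℂ] H)) x‖ =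
      ‖(∑ i ∈ Finset.range n, c i • ((U ^ μ i : unitary (H →L[ℂ] H)) : H →L[ℂ] H)) x‖ := by
  have hnormal : IsStarNormal
      (∑ i ∈ Finset.range n, c i • ((U ^ μ i : unitary (H →L[ℂ] H)) : H →L[ℂ] H)) := by
    constructor
    rw [star_sum]
    refine Commute.sum_left _ _ _ fun i _ => ?_
    rw [star_smul, ← Unitary.coe_star, Unitary.star_eq_inv, ← zpow_neg]
    exact (commute_sum_smul_zpow U n c μ _).symm.smul_left _
  exact (isStarNormal_iff_norm_eq_adjoint.1 hnormal x).symm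

lemma sum_le_sqrt_mul {n : ℕ} {a : ℕ → ℝ} {B : ℝ} (hB : 0 ≤ B)
    (h : n * ∑ k ∈ Finset.range n, a k ^ 2 ≤ B ^ 2) : ∑ k ∈ Finset.range n, a k ≤ B := by
  refine (abs_le_of_sq_le_sq' ?_ hB).2
  refine le_trans ?_ h
  simpa using sq_sum_le_card_mul_sum_sq (s := Finset.range n) (f := a)

lemma exists_transformer_block {N : ℕ} (hN : 0 < N) (U V : unitary (H →L[ℂ] H)) (t : ℕ)
    (ht : t ≤ 2 * N) {g : ℂ → ℂ} {δ : ℝ} (hδ : 0 ≤ δ) (hg : ∀ z, ‖z‖ = 1 → ‖g z‖ ≤ δ) :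
    ∃ Φ : (H →L[ℂ] H) →ₗ[ℂ] (H →L[ℂ] H), IsTransformer Φ (10 * N ^ 2 * δ) ∧
      Φ (U - V) = ∑ i ∈ Finset.range N, ∑ k ∈ Finset.range (4 * N),
        nodeCoeff N ((k : ℤ) - t - i) g •
          (((U ^ ((k : ℤ) - t - i) : unitary (H →L[ℂ] H)) : H →L[ℂ] H)
            - ((V ^ ((k : ℤ) - t - i) : unitary (H →L[ℂ] H)) : H →L[ℂ] H)) := by
  set ζ := nodeRoot N with hζ
  have hprim : IsPrimitiveRoot ζ (8 * N) := nodeRoot_isPrimitiveRoot hN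
  have hζ0 : ζ ≠ 0 := nodeRoot_ne_zero N
  have hζn : ‖ζ‖ = 1 := nodeRoot_norm hN
  set γ : ℕ → ℂ := fun r => g (ζ ^ r) * (ζ ^ r) ^ (t : ℤ) with hγ
  have hγδ : ∀ r, ‖γ r‖ ≤ δ := by
    intro r
    simp only [hγ, norm_mul, norm_zpow, norm_pow, hζn, one_pow, one_zpow, mul_one]
    exact hg _ (by simp [hζn])
  have hcoef : ∀ i k : ℕ, nodeCoeff N ((k : ℤ) - t - i) g = ((8 * N : ℕ) : ℂ)⁻¹ *
      ∑ r ∈ Finset.range (8 * N), γ r * ζ⁻¹ ^ (r * k) * ζ ^ (r * i) := by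
    intro i k
    rw [nodeCoeff_apply]
    congr 1
    refine Finset.sum_congr rfl fun r _ => ?_
    simp only [hγ]
    rw [mul_assoc, mul_assoc]
    congr 1
    rw [← hζ, inv_pow, pow_mul ζ r k, pow_mul ζ r i, ← zpow_natCast (ζ ^ r) k,
      ← zpow_natCast (ζ ^ r) i, ← zpow_neg, ← zpow_add₀ (pow_ne_zero r hζ0),
      ← zpow_add₀ (pow_ne_zero r hζ0)]
    congr 1
    ring
  set Z : ℕ → H →L[ℂ] H := fun k => ∑ i ∈ Finset.range N, nodeCoeff N ((k : ℤ) - t - i) g •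
    ((U ^ (-(i : ℤ)) : unitary (H →L[ℂ] H)) : H →L[ℂ] H) with hZ
  set W : ℕ → H →L[ℂ] H := fun i => ∑ k ∈ Finset.range (4 * N), nodeCoeff N ((k : ℤ) - t - i) g •
    ((V ^ ((k : ℤ) - t) : unitary (H →L[ℂ] H)) : H →L[ℂ] H) with hW
  have hNr : (0 : ℝ) < N := by exact_mod_cast hN
  have hZ2 : ∀ x, ∑ k ∈ Finset.range (4 * N), ‖Z k x‖ ^ 2 ≤ δ ^ 2 * (N * ‖x‖ ^ 2) := by
    intro x
    have h := sum_norm_sq_toeplitz_le hprim.inv hprim (by omega) (show N ≤ 8 * N by omega)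
      (show 4 * N ≤ 8 * N by omega) hγδ
      (fun i => ((U ^ (-(i : ℤ)) : unitary (H →L[ℂ] H)) : H →L[ℂ] H) x)
    simp only [norm_unitary_apply, Finset.sum_const, Finset.card_range, nsmul_eq_mul] at h
    refine le_trans (le_of_eq ?_) h
    refine Finset.sum_congr rfl fun k _ => ?_
    simp only [hZ, hcoef, sum_apply, smul_apply]
  have hW2 : ∀ x, ∑ i ∈ Finset.range N, ‖W i x‖ ^ 2 ≤ δ ^ 2 * ((4 * N) * ‖x‖ ^ 2) := by
    intro x
    have h := sum_norm_sq_toeplitz_le hprim hprim.inv (by omega) (show 4 * N ≤ 8 * N by omega)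
      (show N ≤ 8 * N by omega) hγδ
      (fun k => ((V ^ ((k : ℤ) - t) : unitary (H →L[ℂ] H)) : H →L[ℂ] H) x)
    simp only [norm_unitary_apply, Finset.sum_const, Finset.card_range, nsmul_eq_mul] at h
    push_cast at h
    refine le_trans (le_of_eq ?_) h
    refine Finset.sum_congr rfl fun i _ => ?_
    simp only [hW, hcoef, sum_apply, smul_apply]
    push_cast
    simp only [mul_right_comm]
  have hadj1 : ∀ x : H, ‖adjoint (1 : H →L[ℂ] H) x‖ = ‖(1 : H →L[ℂ] H) x‖ := by
    intro x
    rw [← star_eq_adjoint, star_one]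
  obtain ⟨Φ, hΦ, hΦeq⟩ := exists_transformer_sum_zpow U V (4 * N) (fun k => (k : ℤ) - t) (4 * N)
    (fun k hk => by omega) Z (fun _ => 1) (A := 2 * N * δ) (by positivity)
    (fun k x => norm_adjoint_sum_smul_zpow U N _ _ x) (fun _ x => hadj1 x)
    (fun k l => commute_sum_smul_zpow U N _ _ l) (fun _ _ => Commute.one_left _)
    (fun x y => by
      rw [← Finset.sum_mul, ← mul_assoc]
      gcongr
      · refine sum_le_sqrt_mul (by positivity) ?_
        have := mul_le_mul_of_nonneg_left (hZ2 x) (show (0 : ℝ) ≤ 4 * N by positivity)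
        push_cast
        nlinarith
      · exact le_rfl)
  obtain ⟨Ψ, hΨ, hΨeq⟩ := exists_transformer_sum_zpow U V N (fun i => -(i : ℤ)) N
    (fun k hk => by omega) (fun _ => 1) W (A := 2 * N * δ) (by positivity) (fun _ x => hadj1 x)
    (fun k x => norm_adjoint_sum_smul_zpow V (4 * N) _ _ x) (fun _ _ => Commute.one_left _)
    (fun k l => commute_sum_smul_zpow V (4 * N) _ _ l)
    (fun x y => by
      change ∑ k ∈ Finset.range N, ‖x‖ * ‖W k y‖ ≤ _
      rw [← Finset.mul_sum, mul_left_comm]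
      gcongr
      refine sum_le_sqrt_mul (by positivity) ?_
      have := mul_le_mul_of_nonneg_left (hW2 y) hNr.le
      nlinarith)
  refine ⟨Φ + Ψ, (hΦ.add hΨ).mono (le_of_eq (by push_cast; ring)), ?_⟩
  rw [LinearMap.add_apply, hΦeq, hΨeq]
  simp only [hZ, hW, mul_one, one_mul, Finset.sum_mul, Finset.mul_sum]
  rw [Finset.sum_comm, ← Finset.sum_add_distrib]
  refine Finset.sum_congr rfl fun i _ => ?_
  rw [← Finset.sum_add_distrib]
  refine Finset.sum_congr rfl fun k _ => ?_
  rw [smul_mul_assoc, mul_smul_comm, ← smul_add]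
  congr 1
  have e : ∀ u : unitary (H →L[ℂ] H), u ^ ((k : ℤ) - t - i) = u ^ (-(i : ℤ)) * u ^ ((k : ℤ) - t) := by
    intro u; rw [← zpow_add]; congr 1; ring
  rw [e U, e V]
  push_cast
  noncomm_ring

lemma spectrum_norm_eq_one (U : unitary (H →L[ℂ] H)) {z : ℂ}
    (hz : z ∈ spectrum ℂ (U : H →L[ℂ] H)) : ‖z‖ = 1 := by
  simpa using spectrum.subset_circle_of_unitary U.2 hz

lemma cfc_zpow_unitary (U : unitary (H →L[ℂ] H)) (m : ℤ) :
    cfc (fun z : ℂ => z ^ m) (U : H →L[ℂ] H)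
      = ((U ^ m : unitary (H →L[ℂ] H)) : H →L[ℂ] H) := by
  have h := cfc_zpow (R := ℂ) (Unitary.toUnits U) m
    (by simpa using (inferInstance : IsStarNormal (U : H →L[ℂ] H)))
  rw [← map_zpow] at h
  exact h

lemma continuousOn_zpow_spectrum (U : unitary (H →L[ℂ] H)) (m : ℤ) :
    ContinuousOn (fun z : ℂ => z ^ m) (spectrum ℂ (U : H →L[ℂ] H)) :=
  continuousOn_id.zpow₀ m fun z hz => Or.inl (by
    rintro rfl
    simpa using spectrum_norm_eq_one U hz)

lemma continuousOn_trigMean (U : unitary (H →L[ℂ] H)) (N : ℕ) (g : ℂ → ℂ) :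
    ContinuousOn (trigMean N g) (spectrum ℂ (U : H →L[ℂ] H)) := by
  change ContinuousOn (fun z => trigMean N g z) _
  simp only [trigMean_apply]
  exact continuousOn_const.mul (continuousOn_finsetSum _ fun j _ => continuousOn_finsetSum _
    fun i _ => continuousOn_finsetSum _ fun k _ =>
      continuousOn_const.mul (continuousOn_zpow_spectrum U _))

lemma cfc_finset_sum_fun {ι : Type*} (s : Finset ι) (f : ι → ℂ → ℂ) (a : H →L[ℂ] H)
    (hf : ∀ i ∈ s, ContinuousOn (f i) (spectrum ℂ a)) :
    cfc (fun z => ∑ i ∈ s, f i z) a = ∑ i ∈ s, cfc (f i) a := by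
  rw [← cfc_sum f a s hf]
  congr 1
  ext z
  simp

lemma cfc_trigMean (U : unitary (H →L[ℂ] H)) (N : ℕ) (g : ℂ → ℂ) :
    cfc (trigMean N g) (U : H →L[ℂ] H) = ((N : ℂ) ^ 2)⁻¹ • ∑ j ∈ Finset.range N,
      ∑ i ∈ Finset.range N, ∑ k ∈ Finset.range (4 * N), nodeCoeff N (meanFreq N i j k) g •
        ((U ^ meanFreq N i j k : unitary (H →L[ℂ] H)) : H →L[ℂ] H) := by
  have hc : ∀ i j k, ContinuousOn (fun z => nodeCoeff N (meanFreq N i j k) g *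
      z ^ meanFreq N i j k) (spectrum ℂ (U : H →L[ℂ] H)) :=
    fun i j k => continuousOn_const.mul (continuousOn_zpow_spectrum U _)
  change cfc (fun z => trigMean N g z) _ = _
  simp only [trigMean_apply]
  rw [cfc_const_mul _ _ _ (continuousOn_finsetSum _ fun j _ => continuousOn_finsetSum _
    fun i _ => continuousOn_finsetSum _ fun k _ => hc i j k)]
  congr 1
  rw [cfc_finset_sum_fun _ _ _ fun j _ => continuousOn_finsetSum _ fun i _ =>
    continuousOn_finsetSum _ fun k _ => hc i j k]
  refine Finset.sum_congr rfl fun j _ => ?_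
  rw [cfc_finset_sum_fun _ _ _ fun i _ => continuousOn_finsetSum _ fun k _ => hc i j k]
  refine Finset.sum_congr rfl fun i _ => ?_
  rw [cfc_finset_sum_fun _ _ _ fun k _ => hc i j k]
  refine Finset.sum_congr rfl fun k _ => ?_
  rw [cfc_const_mul _ _ _ (continuousOn_zpow_spectrum U _), cfc_zpow_unitary]

/-- The operator Bernstein inequality for the means `trigMean`. -/
lemma exists_transformer_trigMean {N : ℕ} (hN : 0 < N) (U V : unitary (H →L[ℂ] H)) {g : ℂ → ℂ}
    {δ : ℝ} (hδ : 0 ≤ δ) (hg : ∀ z, ‖z‖ = 1 → ‖g z‖ ≤ δ) :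
    ∃ Φ : (H →L[ℂ] H) →ₗ[ℂ] (H →L[ℂ] H), IsTransformer Φ (10 * N * δ) ∧
      Φ (U - V) = cfc (trigMean N g) (U : H →L[ℂ] H) - cfc (trigMean N g) (V : H →L[ℂ] H) := by
  have hblock : ∀ j ∈ Finset.range N, ∃ Φ : (H →L[ℂ] H) →ₗ[ℂ] (H →L[ℂ] H),
      IsTransformer Φ (10 * N ^ 2 * δ) ∧
      Φ (U - V) = ∑ i ∈ Finset.range N, ∑ k ∈ Finset.range (4 * N),
        nodeCoeff N (meanFreq N i j k) g •
          (((U ^ meanFreq N i j k : unitary (H →L[ℂ] H)) : H →L[ℂ] H)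
            - ((V ^ meanFreq N i j k : unitary (H →L[ℂ] H)) : H →L[ℂ] H)) := by
    intro j hj
    have := exists_transformer_block hN U V (N + j)
      (by have := Finset.mem_range.1 hj; omega) hδ hg
    simpa only [meanFreq, Nat.cast_add] using this
  choose! Φ hΦ hΦeq using hblock
  refine ⟨((N : ℂ) ^ 2)⁻¹ • ∑ j ∈ Finset.range N, Φ j,
    ((IsTransformer.sum _ hΦ).smul _).mono (le_of_eq ?_), ?_⟩
  · have hNr : (N : ℝ) ≠ 0 := by exact_mod_cast hN.ne'
    simp only [norm_inv, norm_pow, Complex.norm_natCast, Finset.sum_const, Finset.card_range,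
      nsmul_eq_mul]
    field_simp
  · rw [LinearMap.smul_apply, LinearMap.sum_apply, Finset.sum_congr rfl hΦeq, cfc_trigMean,
      cfc_trigMean, ← smul_sub]
    simp only [← Finset.sum_sub_distrib, smul_sub]

end Bernstein

section Hoelder

lemma hoelderCircleNorm_nonneg (α : ℝ) (f : ℂ → ℂ) : 0 ≤ hoelderCircleNorm α f :=
  Real.sInf_nonneg fun _ h => h.1

lemma MemHoelderCircle.hoelderCircleWith_norm {α : ℝ} {f : ℂ → ℂ} (hf : MemHoelderCircle α f) :
    HoelderCircleWith (hoelderCircleNorm α f) α f := by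
  obtain ⟨C₀, hC₀, hC₀f⟩ := hf
  intro ζ τ hζ hτ
  rcases (Real.rpow_nonneg (norm_nonneg (ζ - τ)) α).eq_or_lt' with h0 | h0
  · simpa [h0] using hC₀f ζ τ hζ hτ
  · rw [← div_le_iff₀ h0]
    exact le_csInf ⟨C₀, hC₀, hC₀f⟩ fun C hC => (div_le_iff₀ h0).2 (hC.2 ζ τ hζ hτ)

lemma HoelderCircleWith.continuousOn {C α : ℝ} {f : ℂ → ℂ} (hα : 0 < α)
    (hf : HoelderCircleWith C α f) : ContinuousOn f {z | ‖z‖ = 1} := by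
  intro z hz
  refine tendsto_iff_norm_sub_tendsto_zero.2 ?_
  have hlim : Filter.Tendsto (fun w => C * ‖w - z‖ ^ α) (nhdsWithin z {z | ‖z‖ = 1}) (nhds 0) := by
    have hc : Continuous fun w : ℂ => C * ‖w - z‖ ^ α :=
      continuous_const.mul ((continuous_id.sub continuous_const).norm.rpow_const fun _ => Or.inr hα.le)
    have := hc.tendsto z
    simp only [sub_self, norm_zero, Real.zero_rpow hα.ne', mul_zero] at this
    exact this.mono_left nhdsWithin_le_nhds
  refine squeeze_zero' (Filter.Eventually.of_forall fun _ => norm_nonneg _) ?_ hlim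
  filter_upwards [self_mem_nhdsWithin] with w hw using hf w z hw hz

end Hoelder

section Assembly

variable {H : Type} [NormedAddCommGroup H] [InnerProductSpace ℂ H] [CompleteSpace H]

lemma exists_transformer_trigMean_four_pow {α h K : ℝ} {f : ℂ → ℂ} (hα0 : 0 < α) (hα1 : α < 1)
    (hh : 0 ≤ h) (hf : HoelderCircleWith h α f) (hK : 20 ≤ K)
    (hK' : 160 ≤ K * ((4 : ℝ) ^ (1 - α) - 1)) (U V : unitary (H →L[ℂ] H)) (n : ℕ) :
    ∃ Φ : (H →L[ℂ] H) →ₗ[ℂ] (H →L[ℂ] H), IsTransformer Φ (K * ((4 : ℝ) ^ n) ^ (1 - α) * h) ∧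
      Φ (U - V) = cfc (trigMean (4 ^ n) f) (U : H →L[ℂ] H)
        - cfc (trigMean (4 ^ n) f) (V : H →L[ℂ] H) := by
  induction n with
  | zero =>
    have hg : ∀ z, ‖z‖ = 1 → ‖(f - fun _ => f 1 : ℂ → ℂ) z‖ ≤ 2 * h := by
      intro z hz
      have h2 : ‖z - 1‖ ≤ 2 := (norm_sub_le _ _).trans (by rw [hz, norm_one]; norm_num)
      calc ‖f z - f 1‖ ≤ h * ‖z - 1‖ ^ α := hf z 1 hz norm_one
        _ ≤ h * 2 ^ (1 : ℝ) := by
            gcongr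
            exact (Real.rpow_le_rpow (norm_nonneg _) h2 hα0.le).trans
              (Real.rpow_le_rpow_of_exponent_le (by norm_num) hα1.le)
        _ = 2 * h := by rw [Real.rpow_one]; ring
    obtain ⟨Φ, hΦ, hΦeq⟩ := exists_transformer_trigMean one_pos U V (by positivity) hg
    refine ⟨Φ, hΦ.mono ?_, ?_⟩
    · simp only [pow_zero, Real.one_rpow]
      push_cast
      nlinarith
    · have hsplit : trigMean 1 (f - fun _ => f 1) = fun z => trigMean 1 f z - f 1 := by
        rw [map_sub]
        ext z
        rw [Pi.sub_apply, trigMean_const one_pos]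
      rw [hΦeq, hsplit, pow_zero]
      rw [cfc_sub _ _ _ (continuousOn_trigMean U _ _) continuousOn_const,
        cfc_sub _ _ _ (continuousOn_trigMean V _ _) continuousOn_const, cfc_const _ _, cfc_const _ _,
        sub_sub_sub_cancel_right]
  | succ n ih =>
    obtain ⟨Φ, hΦ, hΦeq⟩ := ih
    have hx : (0 : ℝ) < (4 : ℝ) ^ n := by positivity
    have hN : 0 < 4 ^ n := by positivity
    have hg : ∀ z, ‖z‖ = 1 → ‖(f - trigMean (4 ^ n) f) z‖ ≤ 4 * h * ((4 : ℝ) ^ n) ^ (-α) := by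
      intro z hz
      simpa using norm_sub_trigMean_le hN hh hα0 hα1 hf hz
    obtain ⟨Ψ, hΨ, hΨeq⟩ := exists_transformer_trigMean (N := 4 ^ (n + 1)) (by positivity) U V
      (by positivity) hg
    have hcomp : trigMean (4 ^ (n + 1)) (f - trigMean (4 ^ n) f)
        = fun z => trigMean (4 ^ (n + 1)) f z - trigMean (4 ^ n) f z := by
      rw [map_sub, trigMean_trigMean (by positivity) (by rw [pow_succ]; omega)]
      rfl
    refine ⟨Φ + Ψ, (hΦ.add hΨ).mono ?_, ?_⟩
    · have h1 : ((4 : ℝ) ^ (n + 1)) ^ (1 - α) = 4 ^ (1 - α) * ((4 : ℝ) ^ n) ^ (1 - α) := by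
        rw [pow_succ', Real.mul_rpow (by norm_num) hx.le]
      have h2 : ((4 : ℝ) ^ n) ^ (1 - α) = (4 : ℝ) ^ n * ((4 : ℝ) ^ n) ^ (-α) := by
        rw [sub_eq_add_neg, Real.rpow_add hx, Real.rpow_one]
      have h3 : 0 ≤ ((4 : ℝ) ^ n) ^ (1 - α) * h := by positivity
      rw [h1]
      push_cast
      have h4 : 10 * (4 : ℝ) ^ (n + 1) * (4 * h * ((4 : ℝ) ^ n) ^ (-α))
          = 160 * (((4 : ℝ) ^ n) ^ (1 - α) * h) := by rw [h2]; ring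
      rw [h4]
      nlinarith [mul_le_mul_of_nonneg_right hK' h3]
    · rw [LinearMap.add_apply, hΦeq, hΨeq, hcomp, cfc_sub _ _ _ (continuousOn_trigMean U _ _)
        (continuousOn_trigMean U _ _), cfc_sub _ _ _ (continuousOn_trigMean V _ _)
        (continuousOn_trigMean V _ _)]
      abel

lemma norm_cfc_sub_cfc_trigMean_le {α h : ℝ} {f : ℂ → ℂ} (hα0 : 0 < α) (hα1 : α < 1)
    (hh : 0 ≤ h) (hf : HoelderCircleWith h α f) (U : unitary (H →L[ℂ] H)) (n : ℕ) :
    ‖cfc f (U : H →L[ℂ] H) - cfc (trigMean (4 ^ n) f) (U : H →L[ℂ] H)‖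
      ≤ 4 * h * ((4 : ℝ) ^ n) ^ (-α) := by
  rw [← cfc_sub _ _ _ ((hf.continuousOn hα0).mono fun z hz => spectrum_norm_eq_one U hz)
    (continuousOn_trigMean U _ _)]
  refine norm_cfc_le (by positivity) fun z hz => ?_
  simpa using norm_sub_trigMean_le (N := 4 ^ n) (by positivity) hh hα0 hα1 hf
    (spectrum_norm_eq_one U hz)

lemma sVal_cfc_sub_two_mul_le {α h K : ℝ} {f : ℂ → ℂ} (hα0 : 0 < α) (hα1 : α < 1)
    (hh : 0 ≤ h) (hf : HoelderCircleWith h α f) (hK : 20 ≤ K)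
    (hK' : 160 ≤ K * ((4 : ℝ) ^ (1 - α) - 1)) (U V : unitary (H →L[ℂ] H)) (k n : ℕ) :
    sVal (cfc f (U : H →L[ℂ] H) - cfc f (V : H →L[ℂ] H)) (2 * k) ≤
      h * (25 * K * (((4 : ℝ) ^ n) ^ (1 - α) *
        ((∑ i ∈ Finset.range (k + 1), sVal ((U : H →L[ℂ] H) - (V : H →L[ℂ] H)) i) / (k + 1))) +
          8 * ((4 : ℝ) ^ n) ^ (-α)) := by
  obtain ⟨Φ, hΦ, hΦeq⟩ := exists_transformer_trigMean_four_pow hα0 hα1 hh hf hK hK' U V n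
  have h1 := hΦ.sVal_two_mul_le (by positivity) ((U : H →L[ℂ] H) - V) k
  have h2 := sVal_le_add_norm_sub (cfc f (U : H →L[ℂ] H) - cfc f (V : H →L[ℂ] H))
    (Φ (U - V)) (2 * k)
  have h3 : ‖cfc f (U : H →L[ℂ] H) - cfc f (V : H →L[ℂ] H) - Φ (U - V)‖
      ≤ 4 * h * ((4 : ℝ) ^ n) ^ (-α) + 4 * h * ((4 : ℝ) ^ n) ^ (-α) := by
    rw [hΦeq, sub_sub_sub_comm]
    exact (norm_sub_le _ _).trans (add_le_add (norm_cfc_sub_cfc_trigMean_le hα0 hα1 hh hf U n)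
      (norm_cfc_sub_cfc_trigMean_le hα0 hα1 hh hf V n))
  calc _ ≤ _ := h2
    _ ≤ _ := add_le_add h1 h3
    _ = _ := by ring

/-- Optimizing a bound over the scales `4 ^ n`. -/
lemma le_mul_rpow_of_forall_four_pow {α h K a S : ℝ} (hα0 : 0 < α) (hα1 : α < 1) (hh : 0 ≤ h)
    (hK : 0 ≤ K) (ha0 : 0 ≤ a) (ha2 : a ≤ 2)
    (hS : ∀ n : ℕ, S ≤ h * (25 * K * (((4 : ℝ) ^ n) ^ (1 - α) * a) + 8 * ((4 : ℝ) ^ n) ^ (-α))) :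
    S ≤ (50 * K + 16) * h * a ^ α := by
  rcases ha0.eq_or_lt' with rfl | ha
  · rw [Real.zero_rpow hα0.ne', mul_zero]
    have hlim : Filter.Tendsto (fun n : ℕ => h * (8 * ((4 : ℝ) ^ (-α)) ^ n)) Filter.atTop
        (nhds 0) := by
      have := tendsto_pow_atTop_nhds_zero_of_lt_one (r := (4 : ℝ) ^ (-α)) (by positivity)
        (Real.rpow_lt_one_of_one_lt_of_neg (by norm_num) (by linarith))
      simpa using (this.const_mul 8).const_mul h
    refine ge_of_tendsto' hlim fun n => ?_
    have := hS n
    rw [mul_zero, mul_zero, zero_add, ← Real.rpow_pow_comm (by norm_num)] at this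
    exact this
  · obtain ⟨n, hn1, hn2⟩ := exists_nat_pow_near (x := 2 / a) (y := 4)
      ((one_le_div ha).2 ha2) (by norm_num)
    have hx : (0 : ℝ) < 4 ^ n := by positivity
    have haα : 0 ≤ a ^ α := by positivity
    have h1 : ((4 : ℝ) ^ n) ^ (1 - α) * a ≤ 2 * a ^ α := by
      calc ((4 : ℝ) ^ n) ^ (1 - α) * a ≤ (2 / a) ^ (1 - α) * a := by
            gcongr
        _ = 2 ^ (1 - α) * a ^ α := by
            rw [Real.div_rpow (by norm_num) ha.le, Real.rpow_sub ha, Real.rpow_one]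
            field_simp
        _ ≤ 2 ^ (1 : ℝ) * a ^ α := by
            gcongr
            · norm_num
            · linarith
        _ = 2 * a ^ α := by rw [Real.rpow_one]
    have h2 : ((4 : ℝ) ^ n) ^ (-α) ≤ 2 * a ^ α := by
      have h3 : ((4 : ℝ) ^ n)⁻¹ ≤ 2 * a := by
        rw [inv_le_iff_one_le_mul₀ hx]
        rw [div_lt_iff₀ ha, pow_succ] at hn2
        nlinarith
      calc ((4 : ℝ) ^ n) ^ (-α) = (((4 : ℝ) ^ n)⁻¹) ^ α := by
            rw [Real.rpow_neg hx.le, Real.inv_rpow hx.le]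
        _ ≤ (2 * a) ^ α := by gcongr
        _ = 2 ^ α * a ^ α := Real.mul_rpow (by norm_num) ha.le
        _ ≤ 2 ^ (1 : ℝ) * a ^ α := by
            gcongr
            norm_num
        _ = 2 * a ^ α := by rw [Real.rpow_one]
    calc S ≤ _ := hS n
      _ ≤ h * (25 * K * (2 * a ^ α) + 8 * (2 * a ^ α)) := by gcongr
      _ = _ := by ring

lemma sum_range_two_mul_le {g : ℕ → ℝ} (hg : Antitone g) (n : ℕ) :
    ∑ j ∈ Finset.range (2 * n), g j ≤ 2 * ∑ k ∈ Finset.range n, g (2 * k) := by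
  induction n with
  | zero => simp
  | succ n ih =>
    rw [Nat.mul_succ, Finset.sum_range_succ, Finset.sum_range_succ, Finset.sum_range_succ]
    linarith [hg (Nat.le_succ (2 * n))]

/-- A singular value bound by powers of Cesàro means yields a Schatten norm bound. -/
lemma schatten_of_sVal_two_mul_le {α p B : ℝ} (hα0 : 0 < α) (hp : 1 < p) (hB : 0 ≤ B)
    {T D : H →L[ℂ] H} (hT : MemSchatten p T)
    (hD : ∀ k, sVal D (2 * k) ≤
      B * ((∑ i ∈ Finset.range (k + 1), sVal T i) / (k + 1)) ^ α) :
    MemSchatten (p / α) D ∧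
      schNorm (p / α) D ≤ (2 * (2 ^ p / (p - 1))) ^ (α / p) * B * schNorm p T ^ α := by
  have hp0 : 0 < p := by linarith
  have hp1 : 0 < p - 1 := by linarith
  have hq : 0 < p / α := by positivity
  have hterm0 : ∀ j, 0 ≤ sVal D j ^ (p / α) := fun j => Real.rpow_nonneg (sVal_nonneg _ _) _
  have hS0 : 0 ≤ ∑' j, sVal T j ^ p := tsum_nonneg fun j => Real.rpow_nonneg (sVal_nonneg _ _) _
  have hanti : Antitone fun j => sVal D j ^ (p / α) := fun i j hij =>
    Real.rpow_le_rpow (sVal_nonneg _ _) (sVal_antitone _ hij) hq.le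
  have hpartial : ∀ n, ∑ j ∈ Finset.range n, sVal D j ^ (p / α) ≤
      2 * (2 ^ p / (p - 1)) * B ^ (p / α) * ∑' j, sVal T j ^ p := by
    intro n
    calc ∑ j ∈ Finset.range n, sVal D j ^ (p / α)
        ≤ ∑ j ∈ Finset.range (2 * n), sVal D j ^ (p / α) :=
          Finset.sum_le_sum_of_subset_of_nonneg
            (Finset.range_subset_range.2 (by omega)) fun j _ _ => hterm0 j
      _ ≤ 2 * ∑ k ∈ Finset.range n, sVal D (2 * k) ^ (p / α) := sum_range_two_mul_le hanti n
      _ ≤ 2 * ∑ k ∈ Finset.range n, B ^ (p / α) *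
          ((∑ i ∈ Finset.range (k + 1), sVal T i) / (k + 1)) ^ p := by
          gcongr with k _
          have ha : 0 ≤ (∑ i ∈ Finset.range (k + 1), sVal T i) / ((k : ℝ) + 1) :=
            div_nonneg (Finset.sum_nonneg fun i _ => sVal_nonneg _ _) (by positivity)
          refine (Real.rpow_le_rpow (sVal_nonneg _ _) (hD k) hq.le).trans (le_of_eq ?_)
          rw [Real.mul_rpow hB (Real.rpow_nonneg ha _), ← Real.rpow_mul ha,
            mul_div_cancel₀ _ hα0.ne']
      _ ≤ 2 * (B ^ (p / α) * (2 ^ p / (p - 1) * ∑ k ∈ Finset.range n, sVal T k ^ p)) := by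
          rw [← Finset.mul_sum]
          gcongr
          exact hardy_sum_le hp (fun i => sVal_nonneg _ _) n
      _ ≤ 2 * (B ^ (p / α) * (2 ^ p / (p - 1) * ∑' j, sVal T j ^ p)) := by
          gcongr
          exact hT.sum_le_tsum _ fun j _ => Real.rpow_nonneg (sVal_nonneg _ _) _
      _ = _ := by ring
  refine ⟨summable_of_sum_range_le hterm0 hpartial, ?_⟩
  unfold schNorm
  calc (∑' j, sVal D j ^ (p / α)) ^ (1 / (p / α))
      ≤ (2 * (2 ^ p / (p - 1)) * B ^ (p / α) * ∑' j, sVal T j ^ p) ^ (1 / (p / α)) :=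
        Real.rpow_le_rpow (tsum_nonneg hterm0)
          (Real.tsum_le_of_sum_range_le hterm0 hpartial) (by positivity)
    _ = _ := by
        rw [Real.mul_rpow (by positivity) hS0, Real.mul_rpow (by positivity) (by positivity),
          ← Real.rpow_mul hB, mul_one_div_cancel hq.ne', Real.rpow_one, ← Real.rpow_mul hS0,
          one_div_div, one_div_mul_eq_div]

lemma cesaro_sVal_le_two (U V : unitary (H →L[ℂ] H)) (k : ℕ) :
    (∑ i ∈ Finset.range (k + 1), sVal ((U : H →L[ℂ] H) - (V : H →L[ℂ] H)) i) / ((k : ℝ) + 1) ≤ 2 := by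
  have hn : ‖(U : H →L[ℂ] H) - (V : H →L[ℂ] H)‖ ≤ 2 := by
    refine ContinuousLinearMap.opNorm_le_bound _ (by norm_num) fun x => ?_
    calc ‖(U : H →L[ℂ] H) x - (V : H →L[ℂ] H) x‖
        ≤ ‖(U : H →L[ℂ] H) x‖ + ‖(V : H →L[ℂ] H) x‖ := norm_sub_le _ _
      _ = 2 * ‖x‖ := by rw [norm_unitary_apply, norm_unitary_apply, two_mul]
  rw [div_le_iff₀ (by positivity)]
  refine (Finset.sum_le_card_nsmul _ _ 2 fun i _ => (sVal_le_norm _ _).trans hn).trans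
    (le_of_eq ?_)
  rw [Finset.card_range, nsmul_eq_mul]
  push_cast
  ring

end Assembly

theorem stmt9 (α p : ℝ) (hα0 : 0 < α) (hα1 : α < 1) (hp : 1 < p) :
    ∃ c : ℝ, 0 < c ∧
      ∀ (H : Type) [NormedAddCommGroup H] [InnerProductSpace ℂ H] [CompleteSpace H]
        [TopologicalSpace.SeparableSpace H],
        ∀ f : ℂ → ℂ, MemHoelderCircle α f →
        ∀ U V : H →L[ℂ] H, U ∈ unitary (H →L[ℂ] H) → V ∈ unitary (H →L[ℂ] H) →
          MemSchatten p (U - V) →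
            MemSchatten (p / α) (cfc f U - cfc f V) ∧
            schNorm (p / α) (cfc f U - cfc f V) ≤
              c * hoelderCircleNorm α f * schNorm p (U - V) ^ α := by
  have hgap : 0 < (4 : ℝ) ^ (1 - α) - 1 :=
    sub_pos.2 (Real.one_lt_rpow (by norm_num) (by linarith))
  have hp1 : 0 < p - 1 := by linarith
  set K : ℝ := max 20 (160 / ((4 : ℝ) ^ (1 - α) - 1)) with hKdef
  have hK : 20 ≤ K := le_max_left _ _
  have hK' : 160 ≤ K * ((4 : ℝ) ^ (1 - α) - 1) := (div_le_iff₀ hgap).1 (le_max_right _ _)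
  have hK0 : 0 ≤ K := by linarith
  refine ⟨(2 * (2 ^ p / (p - 1))) ^ (α / p) * (50 * K + 16), by positivity, ?_⟩
  intro H _ _ _ _ f hf U V hU hV hUV
  have hh := hoelderCircleNorm_nonneg α f
  have hfh := hf.hoelderCircleWith_norm
  have key : ∀ k, sVal (cfc f U - cfc f V) (2 * k) ≤ (50 * K + 16) * hoelderCircleNorm α f *
      ((∑ i ∈ Finset.range (k + 1), sVal (U - V) i) / ((k : ℝ) + 1)) ^ α := fun k =>
    le_mul_rpow_of_forall_four_pow hα0 hα1 hh hK0
      (div_nonneg (Finset.sum_nonneg fun i _ => sVal_nonneg _ _) (by positivity))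
      (cesaro_sVal_le_two ⟨U, hU⟩ ⟨V, hV⟩ k)
      (sVal_cfc_sub_two_mul_le hα0 hα1 hh hfh hK hK' ⟨U, hU⟩ ⟨V, hV⟩ k)
  have := schatten_of_sVal_two_mul_le hα0 hp (by positivity) hUV key
  rwa [← mul_assoc] at this
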